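/- arXiv:1112.6014 — 5 statements merged into one kernel-verified Lean document; each statement's English description precedes it below -/
import Mathlib

section
/- For every integer n ≥ 1, the polynomial I_n(q,t) satisfies the recursion I_n(q,t) = t·I_{n-1}(q,t) + Σ_{k=0}^{n-2} q^{k+1} I_k(q,t) I_{n-k-1}(q,t), as an identity in ℤ[q,t]. -/
open Finset MvPolynomial

/-- `σ` avoids the pattern 321. -/
def Avoids321 {n : ℕ} (σ : Equiv.Perm (Fin n)) : Prop :=
  ¬ ∃ i j k : Fin n, i < j ∧ j < k ∧ σ k < σ j ∧ σ j < σ i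

instance {n : ℕ} : DecidablePred (Avoids321 (n := n)) := fun σ => by
  unfold Avoids321; infer_instance

/-- The set of 321-avoiding permutations of `{1,…,n}` (modelled on `Fin n`). -/
def Av (n : ℕ) : Finset (Equiv.Perm (Fin n)) := univ.filter Avoids321

/-- The number of inversions of a permutation. -/
def invPerm {n : ℕ} (σ : Equiv.Perm (Fin n)) : ℕ :=
  (univ.filter (fun p : Fin n × Fin n => p.1 < p.2 ∧ σ p.2 < σ p.1)).card

/-- Position `i` is a left-right maximum of `σ`. -/
def IsLRMax {n : ℕ} (σ : Equiv.Perm (Fin n)) (i : Fin n) : Prop :=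
  ∀ j, j ≤ i → σ j ≤ σ i

instance {n : ℕ} (σ : Equiv.Perm (Fin n)) : DecidablePred (IsLRMax σ) := fun i => by
  unfold IsLRMax; infer_instance

/-- The number of left-right maxima of `σ`. -/
def lrm {n : ℕ} (σ : Equiv.Perm (Fin n)) : ℕ := (univ.filter (IsLRMax σ)).card

/-- The number of fixed points of `σ`. -/
def fixPerm {n : ℕ} (σ : Equiv.Perm (Fin n)) : ℕ := (univ.filter (fun i => σ i = i)).card

/-- The number of excedances of `σ`. -/
def excPerm {n : ℕ} (σ : Equiv.Perm (Fin n)) : ℕ := (univ.filter (fun i => i < σ i)).card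

/-- The descent set of `σ`: `i` is in it iff `σ` descends from position `i+1` to `i+2`
(0-based index `i` corresponds to the 1-based descent position `i+1`). -/
def DesPerm {n : ℕ} (σ : Equiv.Perm (Fin n)) : Finset (Fin n) :=
  univ.filter (fun i => ∃ h : i.val + 1 < n, σ ⟨i.val + 1, h⟩ < σ i)

/-- The number of descents of `σ`. -/
def desPerm {n : ℕ} (σ : Equiv.Perm (Fin n)) : ℕ := (DesPerm σ).card

/-- The major index of `σ` (descents at 1-based positions). -/
def majPerm {n : ℕ} (σ : Equiv.Perm (Fin n)) : ℕ := ∑ i ∈ DesPerm σ, (i.val + 1)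

/-- Number of `true` letters among the first `i` letters of the word `P`. -/
def UpCt {m : ℕ} (P : Fin m → Bool) (i : ℕ) : ℕ :=
  (univ.filter (fun j : Fin m => j.val < i ∧ P j = true)).card

/-- Number of `false` letters among the first `i` letters of the word `P`. -/
def DownCt {m : ℕ} (P : Fin m → Bool) (i : ℕ) : ℕ :=
  (univ.filter (fun j : Fin m => j.val < i ∧ P j = false)).card

/-- A word (with `true` = U, `false` = D) is a Dyck word: every prefix has at least as
many U's as D's, and the total numbers of U's and D's agree. -/
def IsDyck {m : ℕ} (P : Fin m → Bool) : Prop :=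
  (∀ i, i ≤ m → DownCt P i ≤ UpCt P i) ∧ UpCt P m = DownCt P m

instance {m : ℕ} : DecidablePred (IsDyck (m := m)) := fun P => by
  unfold IsDyck; infer_instance

/-- The Dyck paths of semilength `n`, as words of length `2n`. -/
def DyckSet (n : ℕ) : Finset (Fin (2 * n) → Bool) := univ.filter IsDyck

/-- Valleys (descents of the word, i.e. factors `DU`), recorded by the 0-based
index of the `D` step. -/
def Valleys {m : ℕ} (P : Fin m → Bool) : Finset (Fin m) :=
  univ.filter (fun j => P j = false ∧ ∃ h : j.val + 1 < m, P ⟨j.val + 1, h⟩ = true)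

/-- `des` of a path: the number of valleys. -/
def desPath {m : ℕ} (P : Fin m → Bool) : ℕ := (Valleys P).card

/-- `maj` of a path: the sum of the (1-based) positions of the descents. -/
def majPath {m : ℕ} (P : Fin m → Bool) : ℕ := ∑ j ∈ Valleys P, (j.val + 1)

/-- `α(P) = Σ_{i ∈ Des P} |p_i(P)|_U`. -/
def alphaPath {m : ℕ} (P : Fin m → Bool) : ℕ := ∑ j ∈ Valleys P, UpCt P (j.val + 1)

/-- `β(P) = Σ_{i ∈ Des P} |p_i(P)|_D`. -/
def betaPath {m : ℕ} (P : Fin m → Bool) : ℕ := ∑ j ∈ Valleys P, DownCt P (j.val + 1)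

/-- Peaks (factors `UD`), recorded by the 0-based index of the `U` step. -/
def Peaks {m : ℕ} (P : Fin m → Bool) : Finset (Fin m) :=
  univ.filter (fun j => P j = true ∧ ∃ h : j.val + 1 < m, P ⟨j.val + 1, h⟩ = false)

/-- The number of peaks of `P`. -/
def npea {m : ℕ} (P : Fin m → Bool) : ℕ := (Peaks P).card

/-- `spea P = Σ_p (HT(p) - 1)` over peaks `p`, where `HT` is the height of a peak. -/
def spea {m : ℕ} (P : Fin m → Bool) : ℕ :=
  ∑ j ∈ Peaks P, (UpCt P (j.val + 1) - DownCt P (j.val + 1) - 1)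

/-- The height of the path after `i` steps. -/
def htAt {m : ℕ} (P : Fin m → Bool) (i : ℕ) : ℤ := (UpCt P i : ℤ) - (DownCt P i : ℤ)

/-- The start of the tunnel of the valley whose lowest lattice point comes after
`k` steps: the largest `m < k` at which the path has the same height. -/
def tunnelStart {m : ℕ} (P : Fin m → Bool) (k : ℕ) : ℕ :=
  ((Finset.range k).filter (fun j => htAt P j = htAt P k)).sup id

/-- `stun P`: the sum over all valleys of the semilengths of their tunnels. -/
def stun {m : ℕ} (P : Fin m → Bool) : ℕ :=
  ∑ j ∈ Valleys P, (j.val + 1 - tunnelStart P (j.val + 1)) / 2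

/-- A parallelogram polyomino: a pair `(U,V)` of `N/E`-paths (`true` = N, `false` = E)
of the same length, with the same endpoints, such that `U` stays strictly above `V`
except at the endpoints (i.e. every proper nonempty prefix of `U` contains strictly
more `N`-steps than the corresponding prefix of `V`).  As noted by Fürlinger and
Hofbauer, the lower path begins with an `E`-step and the upper path ends with an
`E`-step; this is automatic for `m ≥ 2` and fixes the convention in the degenerate
case `m = 1`. -/
def IsParaPoly {m : ℕ} (U V : Fin m → Bool) : Prop :=
  UpCt U m = UpCt V m ∧ (∀ i, i < m → 1 ≤ i → UpCt V i < UpCt U i) ∧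
    UpCt V 1 = 0 ∧ UpCt U m = UpCt U (m - 1)

instance {m : ℕ} (U V : Fin m → Bool) : Decidable (IsParaPoly U V) := by
  unfold IsParaPoly; infer_instance

/-- The parallelogram polyominoes of size `n`. -/
def ParaSet (n : ℕ) : Finset ((Fin n → Bool) × (Fin n → Bool)) :=
  univ.filter (fun UV => IsParaPoly UV.1 UV.2)

/-- A shortened polyomino: a pair `(P,Q)` of `N/E`-paths of the same length with the
same endpoints such that `P` stays weakly above `Q` and the two paths share no
`N`-steps (an `N`-step is shared exactly when it occurs at the same index with equal
prefix `N`-counts). -/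
def IsShortPoly {m : ℕ} (P Q : Fin m → Bool) : Prop :=
  UpCt P m = UpCt Q m ∧ (∀ i, i ≤ m → UpCt Q i ≤ UpCt P i) ∧
    ∀ j : Fin m, UpCt P j.val = UpCt Q j.val → ¬(P j = true ∧ Q j = true)

instance {m : ℕ} (P Q : Fin m → Bool) : Decidable (IsShortPoly P Q) := by
  unfold IsShortPoly; infer_instance

/-- The shortened polyominoes of size `n`. -/
def ShortSet (n : ℕ) : Finset ((Fin n → Bool) × (Fin n → Bool)) :=
  univ.filter (fun PQ => IsShortPoly PQ.1 PQ.2)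

/-- The sum, over the `E`-steps of a path, of their heights (`N`-count before the step). -/
def eSum {m : ℕ} (W : Fin m → Bool) : ℕ :=
  ∑ j ∈ univ.filter (fun j : Fin m => W j = false), UpCt W j.val

/-- The area between the upper path `U` and the lower path `V`. -/
def areaPoly {m : ℕ} (U V : Fin m → Bool) : ℕ := eSum U - eSum V

/-- The number of columns spanned: the number of `E`-steps of the path. -/
def colPoly {m : ℕ} (W : Fin m → Bool) : ℕ := (univ.filter (fun j : Fin m => W j = false)).card

/-- `I_n(q,t) = Σ_{σ ∈ Av_n(321)} q^{inv σ} t^{lrm σ}`, with `q = X 0`, `t = X 1`. -/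
noncomputable def IPoly (n : ℕ) : MvPolynomial (Fin 2) ℤ :=
  ∑ σ ∈ Av n, X 0 ^ invPerm σ * X 1 ^ lrm σ

/-- `M_n(q,t) = Σ_{σ ∈ Av_n(321)} q^{maj σ} t^{des σ}`, with `q = X 0`, `t = X 1`. -/
noncomputable def MPoly (n : ℕ) : MvPolynomial (Fin 2) ℤ :=
  ∑ σ ∈ Av n, X 0 ^ majPerm σ * X 1 ^ desPerm σ

/-- `I_n(q,t,x) = Σ_{σ ∈ Av_n(321)} q^{inv σ} t^{lrm σ} x^{fix σ}`,
with `q = X 0`, `t = X 1`, `x = X 2`. -/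
noncomputable def IPoly3 (n : ℕ) : MvPolynomial (Fin 3) ℤ :=
  ∑ σ ∈ Av n, X 0 ^ invPerm σ * X 1 ^ lrm σ * X 2 ^ fixPerm σ

/-- `C_n(a,b;t) = Σ_{P ∈ D_n} a^{α(P)} b^{β(P)} t^{des P}`,
with `a = X 0`, `b = X 1`, `t = X 2`. -/
noncomputable def CPoly (n : ℕ) : MvPolynomial (Fin 3) ℤ :=
  ∑ P ∈ DyckSet n, X 0 ^ alphaPath P * X 1 ^ betaPath P * X 2 ^ desPath P

/-- `P_n(q,t) = Σ_{(U,V) ∈ 𝒫_n} q^{area(U,V)} t^{col(U,V)}`, with `q = X 0`, `t = X 1`. -/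
noncomputable def PPoly (n : ℕ) : MvPolynomial (Fin 2) ℤ :=
  ∑ UV ∈ ParaSet n, X 0 ^ areaPoly UV.1 UV.2 * X 1 ^ colPoly UV.1

/-- `I_n(-1,t) = Σ_{σ ∈ Av_n(321)} (-1)^{inv σ} t^{lrm σ} ∈ ℤ[t]`. -/
noncomputable def ISign (n : ℕ) : Polynomial ℤ :=
  ∑ σ ∈ Av n, Polynomial.C ((-1 : ℤ) ^ invPerm σ) * Polynomial.X ^ lrm σ

/-- Substitution `t ↦ q^k t` for polynomials in `q = X 0`, `t = X 1`. -/
noncomputable def subT (k : ℕ) (f : MvPolynomial (Fin 2) ℤ) : MvPolynomial (Fin 2) ℤ :=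
  bind₁ (fun i : Fin 2 => if i = 0 then X 0 else X 0 ^ k * X 1) f

/-- Substitution `t ↦ u` (third variable) for polynomials in `a = X 0`, `b = X 1`, `t = X 2`. -/
noncomputable def subT3 (u : MvPolynomial (Fin 3) ℤ) (f : MvPolynomial (Fin 3) ℤ) :
    MvPolynomial (Fin 3) ℤ :=
  bind₁ (fun i : Fin 3 => if i = 2 then u else X i) f

/-- Substitution `x ↦ 1` (third variable) for polynomials in `q = X 0`, `t = X 1`, `x = X 2`. -/
noncomputable def subX1 (f : MvPolynomial (Fin 3) ℤ) : MvPolynomial (Fin 3) ℤ :=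
  bind₁ (fun i : Fin 3 => if i = 2 then 1 else X i) f

/-- `val σ`: indicator vector of left-right maximum values (`val σ i = 1` iff the value `i`
occurs at a left-right maximum position of `σ`). -/
def valVec {n : ℕ} (σ : Equiv.Perm (Fin n)) (i : Fin n) : ℕ :=
  if ∃ j, IsLRMax σ j ∧ σ j = i then 1 else 0

/-- `pos σ`: indicator vector of left-right maximum positions. -/
def posVec {n : ℕ} (σ : Equiv.Perm (Fin n)) (i : Fin n) : ℕ :=
  if IsLRMax σ i then 1 else 0

/-- The permutation of `Fin (n + 1)` obtained from `σ` by raising all values by one and inserting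
the value `0` at position `p`. -/
def insertMin {n : ℕ} (p : Fin (n + 1)) (σ : Equiv.Perm (Fin n)) : Equiv.Perm (Fin (n + 1)) :=
  (finSuccEquiv' p).trans ((Equiv.optionCongr σ).trans (finSuccEquiv' 0).symm)

@[simp] theorem insertMin_self {n : ℕ} (p : Fin (n + 1)) (σ : Equiv.Perm (Fin n)) :
    insertMin p σ p = 0 := by
  simp [insertMin]

@[simp] theorem insertMin_succAbove {n : ℕ} (p : Fin (n + 1)) (σ : Equiv.Perm (Fin n))
    (i : Fin n) : insertMin p σ (p.succAbove i) = (σ i).succ := by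
  simp [insertMin]

theorem insertMin_bijective (n : ℕ) :
    Function.Bijective (fun x : Fin (n + 1) × Equiv.Perm (Fin n) => insertMin x.1 x.2) := by
  rw [Fintype.bijective_iff_injective_and_card]
  refine ⟨?_, by simp [Fintype.card_perm, Nat.factorial_succ]⟩
  rintro ⟨p, σ⟩ ⟨p', σ'⟩ h
  dsimp only at h
  have hp : p = p' := by
    apply (insertMin p' σ').injective
    rw [insertMin_self, ← h, insertMin_self]
  subst hp
  congr 1
  ext i
  have := congrArg Fin.val (DFunLike.congr_fun h (p.succAbove i))
  simpa using this

/-- The first `m` entries of `σ` exist and are increasing. -/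
def HasIncPrefix {n : ℕ} (σ : Equiv.Perm (Fin n)) (m : ℕ) : Prop :=
  m ≤ n ∧ ∀ i j : Fin n, i < j → j.val < m → σ i < σ j

instance {n : ℕ} (σ : Equiv.Perm (Fin n)) (m : ℕ) : Decidable (HasIncPrefix σ m) := by
  unfold HasIncPrefix; infer_instance

theorem HasIncPrefix.mono {n m m' : ℕ} {σ : Equiv.Perm (Fin n)} (h : HasIncPrefix σ m)
    (hm : m' ≤ m) : HasIncPrefix σ m' :=
  ⟨hm.trans h.1, fun i j hij hj => h.2 i j hij (hj.trans_le hm)⟩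

theorem succAbove_lt_self_iff {n : ℕ} (p : Fin (n + 1)) (i : Fin n) :
    p.succAbove i < p ↔ i.val < p.val := by
  rw [Fin.succAbove_lt_iff_castSucc_lt]; rfl

theorem avoids321_insertMin {n : ℕ} (p : Fin (n + 1)) (σ : Equiv.Perm (Fin n)) :
    Avoids321 (insertMin p σ) ↔ Avoids321 σ ∧ HasIncPrefix σ p.val := by
  constructor
  · intro h
    refine ⟨?_, Nat.lt_succ_iff.mp p.isLt, ?_⟩
    · rintro ⟨i, j, k, hij, hjk, h1, h2⟩
      exact h ⟨p.succAbove i, p.succAbove j, p.succAbove k, by simpa, by simpa, by simpa, by simpa⟩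
    · intro i j hij hj
      by_contra hc
      have hne : σ i ≠ σ j := fun e => hij.ne (σ.injective e)
      exact h ⟨p.succAbove i, p.succAbove j, p, by simpa, (succAbove_lt_self_iff p j).2 hj,
        by simp, by simpa using lt_of_le_of_ne (not_lt.mp hc) hne.symm⟩
  · rintro ⟨h, -, hp⟩ ⟨i, j, k, hij, hjk, h1, h2⟩
    obtain rfl | ⟨i, rfl⟩ := Fin.eq_self_or_eq_succAbove p i
    · simp at h2
    obtain rfl | ⟨j, rfl⟩ := Fin.eq_self_or_eq_succAbove p j
    · simp at h1
    obtain rfl | ⟨k, rfl⟩ := Fin.eq_self_or_eq_succAbove p k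
    · have := hp i j (by simpa using hij) ((succAbove_lt_self_iff k j).1 hjk)
      simp only [insertMin_succAbove, Fin.succ_lt_succ_iff] at h2
      exact absurd h2 this.asymm
    · exact h ⟨i, j, k, by simpa using hij, by simpa using hjk, by simpa using h1,
        by simpa using h2⟩

theorem hasIncPrefix_insertMin_zero {n : ℕ} (σ : Equiv.Perm (Fin n)) (m : ℕ) :
    HasIncPrefix (insertMin 0 σ) (m + 1) ↔ HasIncPrefix σ m := by
  have h0 : insertMin 0 σ 0 = 0 := insertMin_self 0 σ
  have hs : ∀ i : Fin n, insertMin 0 σ i.succ = (σ i).succ := insertMin_succAbove 0 σ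
  simp [HasIncPrefix, Fin.forall_fin_succ, h0, hs]

theorem hasIncPrefix_insertMin {n : ℕ} {p : Fin (n + 1)} (hp : p ≠ 0) {σ : Equiv.Perm (Fin n)}
    (hσ : HasIncPrefix σ p.val) (m : ℕ) :
    HasIncPrefix (insertMin p σ) (m + 1) ↔ m + 1 ≤ p.val := by
  constructor
  · intro h
    by_contra hc
    have := h.2 0 p (Fin.pos_of_ne_zero hp) (not_le.mp hc)
    simp at this
  · intro h
    refine ⟨h.trans p.isLt.le, fun i j hij hj => ?_⟩
    obtain rfl | ⟨j, rfl⟩ := Fin.eq_self_or_eq_succAbove p j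
    · omega
    obtain rfl | ⟨i, rfl⟩ := Fin.eq_self_or_eq_succAbove p i
    · simp
    · have hlt : p.succAbove j < p := by rw [Fin.lt_def]; omega
      simpa using hσ.2 i j (by simpa using hij) ((succAbove_lt_self_iff p j).1 hlt)

theorem invPerm_eq_sum {n : ℕ} (σ : Equiv.Perm (Fin n)) :
    invPerm σ = ∑ i, ∑ j, if i < j ∧ σ j < σ i then 1 else 0 := by
  rw [invPerm, Finset.card_filter, Fintype.sum_prod_type]

theorem invPerm_insertMin {n : ℕ} (p : Fin (n + 1)) (σ : Equiv.Perm (Fin n)) :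
    invPerm (insertMin p σ) = p.val + invPerm σ := by
  have hcard : ∑ i : Fin n, (if p.succAbove i < p then 1 else 0) = p.val := by
    simp only [succAbove_lt_self_iff]
    rw [Fin.sum_univ_eq_sum_range (fun i => if i < p.val then 1 else 0) n, ← Finset.card_filter]
    have : (Finset.range n).filter (· < p.val) = Finset.range p.val := by
      ext i; simp; omega
    rw [this, Finset.card_range]
  rw [invPerm_eq_sum, invPerm_eq_sum, Fin.sum_univ_succAbove _ p]
  simp only [Fin.sum_univ_succAbove _ p, insertMin_self, insertMin_succAbove, Fin.not_lt_zero,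
    and_false, if_false, Finset.sum_const_zero, Fin.succ_pos, and_true, zero_add,
    Finset.sum_add_distrib, Fin.succ_lt_succ_iff, Fin.succAbove_lt_succAbove_iff, hcard]

theorem isLRMax_insertMin_self {n : ℕ} (p : Fin (n + 1)) (σ : Equiv.Perm (Fin n)) :
    IsLRMax (insertMin p σ) p ↔ p = 0 := by
  constructor
  · intro h
    have := h 0 (Fin.zero_le p)
    rw [insertMin_self, Fin.le_zero_iff] at this
    exact (insertMin p σ).injective ((insertMin_self p σ).trans this.symm)
  · rintro rfl j hj
    rw [Fin.le_zero_iff.mp hj]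

theorem isLRMax_insertMin_succAbove {n : ℕ} (p : Fin (n + 1)) (σ : Equiv.Perm (Fin n))
    (i : Fin n) : IsLRMax (insertMin p σ) (p.succAbove i) ↔ IsLRMax σ i := by
  unfold IsLRMax
  rw [Fin.forall_iff_succAbove p]
  simp

theorem lrm_insertMin {n : ℕ} (p : Fin (n + 1)) (σ : Equiv.Perm (Fin n)) :
    lrm (insertMin p σ) = (if p = 0 then 1 else 0) + lrm σ := by
  rw [lrm, lrm, Finset.card_filter, Finset.card_filter, Fin.sum_univ_succAbove _ p]
  simp only [isLRMax_insertMin_self, isLRMax_insertMin_succAbove]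

/-- The part of `IPoly n` coming from the permutations whose first `m` entries are increasing. -/
noncomputable def prefixPoly (n m : ℕ) : MvPolynomial (Fin 2) ℤ :=
  ∑ σ : Equiv.Perm (Fin n),
    if Avoids321 σ ∧ HasIncPrefix σ m then X 0 ^ invPerm σ * X 1 ^ lrm σ else 0

theorem prefixPoly_zero_right (n : ℕ) : prefixPoly n 0 = IPoly n := by
  simp [prefixPoly, IPoly, Av, Finset.sum_filter, HasIncPrefix]

theorem prefixPoly_of_lt {n m : ℕ} (h : n < m) : prefixPoly n m = 0 := by
  simp [prefixPoly, HasIncPrefix, h.not_ge]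

theorem prefixPoly_succ_one (n : ℕ) : prefixPoly (n + 1) 1 = prefixPoly (n + 1) 0 := by
  have h : ∀ σ : Equiv.Perm (Fin (n + 1)), HasIncPrefix σ 1 ↔ HasIncPrefix σ 0 := fun σ =>
    ⟨fun h => h.mono zero_le_one, fun _ => ⟨by omega, fun i j hij hj => by omega⟩⟩
  simp only [prefixPoly, h]

theorem prefixPoly_zero_zero : prefixPoly 0 0 = 1 := by
  simp [prefixPoly, HasIncPrefix, Avoids321, invPerm, lrm]

theorem prefixPoly_succ_succ (n m : ℕ) :
    prefixPoly (n + 1) (m + 1) =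
      X 1 * prefixPoly n m + ∑ p ∈ Finset.Ico (m + 1) (n + 1), X 0 ^ p * prefixPoly n p := by
  have hzero : (∑ σ : Equiv.Perm (Fin n),
      if Avoids321 (insertMin 0 σ) ∧ HasIncPrefix (insertMin 0 σ) (m + 1) then
        (X 0 ^ invPerm (insertMin 0 σ) * X 1 ^ lrm (insertMin 0 σ) : MvPolynomial (Fin 2) ℤ)
      else 0) = X 1 * prefixPoly n m := by
    rw [prefixPoly, Finset.mul_sum]
    refine Finset.sum_congr rfl fun σ _ => ?_
    have h0 : HasIncPrefix σ 0 := ⟨Nat.zero_le _, fun i j _ hj => by omega⟩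
    simp only [avoids321_insertMin, hasIncPrefix_insertMin_zero, invPerm_insertMin, lrm_insertMin,
      Fin.val_zero, h0, and_true, if_true, mul_ite, mul_zero]
    split_ifs <;> ring
  have hsucc : ∀ i : Fin n, (∑ σ : Equiv.Perm (Fin n),
      if Avoids321 (insertMin i.succ σ) ∧ HasIncPrefix (insertMin i.succ σ) (m + 1) then
        (X 0 ^ invPerm (insertMin i.succ σ) * X 1 ^ lrm (insertMin i.succ σ) :
          MvPolynomial (Fin 2) ℤ)
      else 0) = if m ≤ i.val then X 0 ^ (i.val + 1) * prefixPoly n (i.val + 1) else 0 := by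
    intro i
    rw [prefixPoly, Finset.mul_sum]
    split_ifs with hm
    · refine Finset.sum_congr rfl fun σ _ => ?_
      by_cases hσ : HasIncPrefix σ (i.val + 1)
      · have hins : HasIncPrefix (insertMin i.succ σ) (m + 1) :=
          (hasIncPrefix_insertMin (Fin.succ_ne_zero i) hσ m).2 (by simpa using hm)
        simp only [avoids321_insertMin, invPerm_insertMin, lrm_insertMin, Fin.val_succ, hσ, hins,
          Fin.succ_ne_zero, and_true, if_false, mul_ite, mul_zero]
        split_ifs <;> ring
      · simp [avoids321_insertMin, hσ]
    · refine Finset.sum_eq_zero fun σ _ => if_neg ?_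
      rintro ⟨h1, h2⟩
      have hσ := ((avoids321_insertMin _ _).1 h1).2
      have := (hasIncPrefix_insertMin (Fin.succ_ne_zero i) hσ m).1 h2
      rw [Fin.val_succ] at this
      omega
  rw [prefixPoly, ← (insertMin_bijective n).sum_comp, Fintype.sum_prod_type, Fin.sum_univ_succ]
  simp only [hzero, hsucc]
  rw [Fin.sum_univ_eq_sum_range
    (fun i => if m ≤ i then X 0 ^ (i + 1) * prefixPoly n (i + 1) else 0) n, ← Finset.sum_filter,
    ← Finset.sum_Ico_add' (fun p => X 0 ^ p * prefixPoly n p) m n 1]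
  congr 2
  ext i
  simp [and_comm]

theorem prefixPoly_sub (n m : ℕ) :
    prefixPoly (n + 1) (m + 1) - prefixPoly (n + 1) (m + 2) =
      X 1 * (prefixPoly n m - prefixPoly n (m + 1)) + X 0 ^ (m + 1) * prefixPoly n (m + 1) := by
  rw [prefixPoly_succ_succ, prefixPoly_succ_succ]
  rcases lt_or_ge m n with h | h
  · rw [Finset.sum_eq_sum_Ico_succ_bot (by omega)]
    ring
  · rw [Finset.Ico_eq_empty (by omega), Finset.Ico_eq_empty (by omega),
      prefixPoly_of_lt (show n < m + 1 by omega)]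
    ring

/-- The convolution `∑ q^{k+1} B(k, m) B(n - k, 1)` of prefix polynomials. -/
noncomputable def prefixConv (n m : ℕ) : MvPolynomial (Fin 2) ℤ :=
  ∑ k ∈ Finset.range (n + 1), X 0 ^ (k + 1) * prefixPoly k m * prefixPoly (n - k) 1

theorem prefixConv_of_le {n m : ℕ} (h : n ≤ m) : prefixConv n m = 0 := by
  refine Finset.sum_eq_zero fun k hk => ?_
  rw [Finset.mem_range] at hk
  rcases lt_or_ge k m with hkm | hkm
  · rw [prefixPoly_of_lt hkm]; ring
  · rw [prefixPoly_of_lt (show n - k < 1 by omega)]; ring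

theorem prefixConv_sub_zero (n : ℕ) :
    prefixConv n 0 - prefixConv n 1 = X 0 * prefixPoly n 1 := by
  rw [prefixConv, prefixConv, ← Finset.sum_sub_distrib, Finset.sum_range_succ']
  simp [prefixPoly_succ_one, prefixPoly_zero_zero, prefixPoly_of_lt]

theorem prefixConv_sub_succ (n m : ℕ) :
    prefixConv (n + 1) (m + 1) - prefixConv (n + 1) (m + 2) =
      X 0 * X 1 * (prefixConv n m - prefixConv n (m + 1)) +
        X 0 ^ (m + 2) * prefixConv n (m + 1) := by
  simp only [prefixConv]
  rw [Finset.sum_range_succ', Finset.sum_range_succ' _ (n + 1),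
    prefixPoly_of_lt (Nat.succ_pos m), prefixPoly_of_lt (Nat.succ_pos (m + 1))]
  simp only [mul_zero, zero_mul, add_zero, ← Finset.sum_sub_distrib, Finset.mul_sum,
    ← Finset.sum_add_distrib, Nat.add_sub_add_right]
  refine Finset.sum_congr rfl fun k _ => ?_
  linear_combination X 0 ^ (k + 2) * prefixPoly (n - k) 1 * prefixPoly_sub k m

theorem sum_eq_of_sub_eq {n : ℕ} {u v : ℕ → MvPolynomial (Fin 2) ℤ} (hu : ∀ m, n ≤ m → u m = 0)
    (h : ∀ m, u m - u (m + 1) = v (m + 1)) (m : ℕ) :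
    u m = ∑ p ∈ Finset.Ico (m + 1) (n + 1), v p := by
  rcases le_total n m with hm | hm
  · rw [hu m hm, Finset.Ico_eq_empty (by omega), Finset.sum_empty]
  · induction hm using Nat.decreasingInduction with
    | self => simp [hu n le_rfl]
    | of_succ k hk ih =>
      rw [Finset.sum_eq_sum_Ico_succ_bot (by omega), ← ih, ← h]
      ring

theorem prefixConv_sub (n m : ℕ) :
    prefixConv n m - prefixConv n (m + 1) = X 0 ^ (m + 1) * prefixPoly n (m + 1) := by
  induction n generalizing m with
  | zero =>
    rw [prefixConv_of_le (Nat.zero_le _), prefixConv_of_le (Nat.zero_le _),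
      prefixPoly_of_lt (Nat.succ_pos m)]
    ring
  | succ n ih =>
    cases m with
    | zero => simpa using prefixConv_sub_zero (n + 1)
    | succ m =>
      rw [prefixConv_sub_succ, ih, prefixPoly_succ_succ n (m + 1),
        ← sum_eq_of_sub_eq (u := prefixConv n) (fun _ => prefixConv_of_le) ih (m + 1)]
      ring

theorem prefixPoly_succ_succ_eq_conv (n m : ℕ) :
    prefixPoly (n + 1) (m + 1) = X 1 * prefixPoly n m + prefixConv n m := by
  rw [prefixPoly_succ_succ,
    ← sum_eq_of_sub_eq (u := prefixConv n) (fun _ => prefixConv_of_le) (prefixConv_sub n) m]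

/-- For n ≥ 1,
`I_n(q,t) = t·I_{n-1}(q,t) + Σ_{k=0}^{n-2} q^{k+1} I_k(q,t) I_{n-k-1}(q,t)` in ℤ[q,t]. -/
theorem stmt0 (n : ℕ) (hn : 1 ≤ n) :
    IPoly n = X 1 * IPoly (n - 1) +
      ∑ k ∈ Finset.range (n - 1), X 0 ^ (k + 1) * IPoly k * IPoly (n - k - 1) := by
  obtain ⟨n, rfl⟩ := Nat.exists_eq_add_of_le' hn
  rw [← prefixPoly_zero_right, ← prefixPoly_succ_one, prefixPoly_succ_succ_eq_conv, prefixConv,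
    Finset.sum_range_succ, Nat.sub_self, prefixPoly_of_lt zero_lt_one, mul_zero, add_zero,
    Nat.add_sub_cancel, prefixPoly_zero_right]
  congr 1
  refine Finset.sum_congr rfl fun k hk => ?_
  rw [Finset.mem_range] at hk
  obtain ⟨d, hd⟩ : ∃ d, n - k = d + 1 := ⟨n - k - 1, by omega⟩
  rw [show n + 1 - k - 1 = d + 1 by omega, hd, prefixPoly_succ_one, prefixPoly_zero_right,
    prefixPoly_zero_right]
end

section
/- For every integer n ≥ 1, C_n(a,b;t) = C_{n-1}(a,b;abt) + b·t·Σ_{k=0}^{n-2} a^{k+1} C_k(a,b;abt) C_{n-k-1}(a,b;(ab)^{k+1}t), as an identity of polynomials in ℤ[a,b,t], where C_m(a,b;u) denotes the polynomial C_m(a,b;t) with t replaced by u. -/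
open Finset MvPolynomial

section Motzkin

variable {R : Type*} [CommRing R] (a b t : R)

/-- Weighted count of bicoloured Motzkin paths with `L` steps, at positions `x + 1, …, x + L`,
from height `k` to height `1`, staying at height at least `1`; a step at position `p` weighs
`1` or `(ab)^p t` if level, `b^p t` if up and `a^p` if down. -/
def motzkinSum : ℕ → ℕ → ℕ → R
  | 0, _, k => if k = 1 then 1 else 0
  | _ + 1, _, 0 => 0
  | L + 1, x, k + 1 =>
    (1 + (a * b) ^ (x + 1) * t) * motzkinSum L (x + 1) (k + 1) +
      b ^ (x + 1) * t * motzkinSum L (x + 1) (k + 2) + a ^ (x + 1) * motzkinSum L (x + 1) k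

@[simp] lemma motzkinSum_zero_height (L x : ℕ) : motzkinSum a b t L x 0 = 0 := by
  cases L <;> simp [motzkinSum]

lemma motzkinSum_succ (L x k : ℕ) :
    motzkinSum a b t (L + 1) x (k + 1) =
      (1 + (a * b) ^ (x + 1) * t) * motzkinSum a b t L (x + 1) (k + 1) +
        b ^ (x + 1) * t * motzkinSum a b t L (x + 1) (k + 2) +
        a ^ (x + 1) * motzkinSum a b t L (x + 1) k := rfl

lemma map_motzkinSum {S : Type*} [CommRing S] (f : R →+* S) (L x k : ℕ) :
    f (motzkinSum a b t L x k) = motzkinSum (f a) (f b) (f t) L x k := by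
  induction L generalizing x k with
  | zero => simp only [motzkinSum]; split <;> simp
  | succ L ih => cases k <;> simp [motzkinSum, ih]

lemma motzkinSum_add (s L x k : ℕ) :
    motzkinSum a b t L (x + s) (k + 1) =
      a ^ (s * k) * motzkinSum a b ((a * b) ^ s * t) L x (k + 1) := by
  induction L generalizing x k with
  | zero => cases k <;> simp [motzkinSum]
  | succ L ih =>
    have e : x + s + 1 = x + 1 + s := by ring
    cases k with
    | zero => simp only [motzkinSum, e, ih, motzkinSum_zero_height]; ring
    | succ k => simp only [motzkinSum, e, ih]; ring

/-- Decomposition of a bicoloured Motzkin path at its first step down to height `1`. -/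
lemma motzkinSum_first_passage (L x k : ℕ) :
    motzkinSum a b t L x (k + 2) = ∑ i ∈ range L, motzkinSum a b t i x (k + 1) *
      (a ^ (x + i + 1) * motzkinSum a b t (L - 1 - i) (x + i + 1) 1) := by
  induction L generalizing x k with
  | zero => simp [motzkinSum]
  | succ L ih =>
    rw [sum_range_succ']
    have e (i : ℕ) : L + 1 - 1 - (i + 1) = L - 1 - i := by omega
    have e' (i : ℕ) : x + (i + 1) + 1 = x + 1 + i + 1 := by ring
    simp only [e, e']
    cases k with
    | zero =>
      simp only [motzkinSum, ih, motzkinSum_zero_height, mul_sum]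
      simp only [add_mul, sum_add_distrib, mul_zero, add_zero, zero_add, one_mul, if_true,
        Nat.add_sub_cancel, Nat.sub_zero, mul_assoc]
    | succ k =>
      simp only [motzkinSum, ih, mul_sum]
      simp only [add_mul, sum_add_distrib, mul_assoc]
      simp

/-- The sum of `motzkinSum a b t L (y + g) (k + |J|)` over all sets `J` of positions in
`(y, y + g]`, each position `j ∈ J` contributing the weight `b^j t`. -/
def motzkinSubsetSum (L : ℕ) : ℕ → ℕ → ℕ → R
  | 0, y, k => motzkinSum a b t L y k
  | g + 1, y, k =>
    motzkinSubsetSum L g (y + 1) k + b ^ (y + 1) * t * motzkinSubsetSum L g (y + 1) (k + 1)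

lemma motzkinSubsetSum_gap_succ (L g y k : ℕ) :
    motzkinSubsetSum a b t L (g + 1) y k = motzkinSubsetSum a b t L g (y + 1) k +
      b ^ (y + 1) * t * motzkinSubsetSum a b t L g (y + 1) (k + 1) := rfl

lemma motzkinSubsetSum_succ (L g y k : ℕ) :
    motzkinSubsetSum a b t (L + 1) g y (k + 1) = motzkinSubsetSum a b t L (g + 1) y (k + 1) +
      a ^ (y + g + 1) * motzkinSubsetSum a b t L (g + 1) y k := by
  induction g generalizing y k with
  | zero => simp only [motzkinSubsetSum, motzkinSum]; ring
  | succ g ih =>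
    rw [motzkinSubsetSum_gap_succ, ih, ih, motzkinSubsetSum_gap_succ a b t L (g + 1) y (k + 1),
      motzkinSubsetSum_gap_succ a b t L (g + 1) y k]
    ring

lemma motzkinSubsetSum_zero_high (g y k : ℕ) : motzkinSubsetSum a b t 0 g y (k + 2) = 0 := by
  induction g generalizing y k with
  | zero => simp [motzkinSubsetSum, motzkinSum]
  | succ g ih => simp [motzkinSubsetSum, ih]

lemma motzkinSubsetSum_zero_one (g y : ℕ) : motzkinSubsetSum a b t 0 g y 1 = 1 := by
  induction g generalizing y with
  | zero => simp [motzkinSubsetSum, motzkinSum]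
  | succ g ih => simp [motzkinSubsetSum, ih, motzkinSubsetSum_zero_high]

end Motzkin

section Words

lemma UpCt_zero {m : ℕ} (P : Fin m → Bool) : UpCt P 0 = 0 := by simp [UpCt]

lemma DownCt_zero {m : ℕ} (P : Fin m → Bool) : DownCt P 0 = 0 := by simp [DownCt]

lemma UpCt_cons {m : ℕ} (c : Bool) (P : Fin m → Bool) (i : ℕ) :
    UpCt (Fin.cons c P : Fin (m + 1) → Bool) (i + 1) = UpCt P i + c.toNat := by
  simp only [UpCt, card_filter, Fin.sum_univ_succ]
  cases c <;> simp [add_comm]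

lemma DownCt_cons {m : ℕ} (c : Bool) (P : Fin m → Bool) (i : ℕ) :
    DownCt (Fin.cons c P : Fin (m + 1) → Bool) (i + 1) = DownCt P i + (!c).toNat := by
  simp only [DownCt, card_filter, Fin.sum_univ_succ]
  cases c <;> simp [add_comm]

lemma UpCt_add_DownCt {m : ℕ} (P : Fin m → Bool) : UpCt P m + DownCt P m = m := by
  induction m with
  | zero => simp [UpCt, DownCt]
  | succ m ih =>
    rw [← Fin.cons_self_tail P, UpCt_cons, DownCt_cons]
    have := ih (Fin.tail P)
    cases P 0 <;> simp <;> omega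

/-- Appended to a prefix with `x` ups and `y` downs, the word `P` never goes below height `0`
and ends at height `0`. -/
def CompletesDyck {m : ℕ} (x y : ℕ) (P : Fin m → Bool) : Prop :=
  (∀ i, i ≤ m → y + DownCt P i ≤ x + UpCt P i) ∧ x + UpCt P m = y + DownCt P m

instance {m : ℕ} (x y : ℕ) : DecidablePred (CompletesDyck (m := m) x y) := fun P => by
  unfold CompletesDyck; infer_instance

/-- The word `P` starts with an up step. -/
def StartsUp {m : ℕ} (P : Fin m → Bool) : Prop := ∃ h : 0 < m, P ⟨0, h⟩ = true

instance {m : ℕ} : DecidablePred (StartsUp (m := m)) := fun P => by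
  unfold StartsUp; infer_instance

lemma completesDyck_zero_zero {m : ℕ} (P : Fin m → Bool) :
    CompletesDyck 0 0 P ↔ IsDyck P := by
  simp [CompletesDyck, IsDyck]

lemma CompletesDyck.le {m x y : ℕ} {P : Fin m → Bool} (h : CompletesDyck x y P) : y ≤ x := by
  simpa [UpCt_zero, DownCt_zero] using h.1 0 (Nat.zero_le _)

lemma CompletesDyck.le_add {m x y : ℕ} {P : Fin m → Bool} (h : CompletesDyck x y P) :
    x ≤ y + m := by
  have := h.2
  have := UpCt_add_DownCt P
  omega

lemma completesDyck_cons {m x y : ℕ} (hxy : y ≤ x) (c : Bool) (P : Fin m → Bool) :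
    CompletesDyck x y (Fin.cons c P : Fin (m + 1) → Bool) ↔
      CompletesDyck (x + c.toNat) (y + (!c).toNat) P := by
  unfold CompletesDyck
  rw [UpCt_cons, DownCt_cons]
  refine and_congr ⟨fun h i hi => ?_, fun h i hi => ?_⟩ ?_
  · have := h (i + 1) (by omega)
    rw [UpCt_cons, DownCt_cons] at this
    omega
  · rcases i with _ | i
    · simpa [UpCt_zero, DownCt_zero] using hxy
    · have := h i (by omega)
      rw [UpCt_cons, DownCt_cons]
      omega
  · omega

variable {R : Type*} [CommRing R] (a b t : R)

/-- The product of the weights of the valleys of `P`, when `P` is appended to a prefix with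
`x` ups and `y` downs. -/
def valleyWeight {m : ℕ} (x y : ℕ) (P : Fin m → Bool) : R :=
  ∏ j ∈ Valleys P, (a ^ (x + UpCt P (j.val + 1)) * b ^ (y + DownCt P (j.val + 1)) * t)

lemma valleyWeight_cons {m : ℕ} (x y : ℕ) (c : Bool) (P : Fin m → Bool) :
    valleyWeight a b t x y (Fin.cons c P : Fin (m + 1) → Bool) =
      (if c = false ∧ StartsUp P then a ^ x * b ^ (y + 1) * t else 1) *
        valleyWeight a b t (x + c.toNat) (y + (!c).toNat) P := by
  simp only [valleyWeight, Valleys, prod_filter, Fin.prod_univ_succ]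
  congr 1
  · have h : (∃ h : 0 + 1 < m + 1, (Fin.cons c P : Fin (m + 1) → Bool) ⟨0 + 1, h⟩ = true) ↔
        StartsUp P :=
      ⟨fun ⟨h, e⟩ => ⟨by omega, e⟩, fun ⟨h, e⟩ => ⟨by omega, e⟩⟩
    have hU := UpCt_cons c P 0
    have hD := DownCt_cons c P 0
    simp only [Fin.val_zero, Fin.cons_zero, h, hU, hD, UpCt_zero, DownCt_zero]
    cases c <;> simp
  · refine Fintype.prod_congr _ _ fun j => ?_
    have h : (∃ h : j.succ.val + 1 < m + 1,
          (Fin.cons c P : Fin (m + 1) → Bool) ⟨j.succ.val + 1, h⟩ = true) ↔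
        ∃ h : j.val + 1 < m, P ⟨j.val + 1, h⟩ = true :=
      ⟨fun ⟨h, e⟩ => ⟨by simpa using h, e⟩, fun ⟨h, e⟩ => ⟨by simpa using h, e⟩⟩
    simp only [Fin.cons_succ, h]
    simp only [Fin.val_succ, UpCt_cons, DownCt_cons]
    congr 3 <;> ring

/-- Weighted count of the completions of length `m` of a prefix with `x` ups and `y` downs which
does not end with a down step. -/
def upSum (m x y : ℕ) : R :=
  ∑ P : Fin m → Bool with CompletesDyck x y P, valleyWeight a b t x y P

/-- Weighted count of the completions of length `m` of a prefix with `x` ups and `y` downs which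
ends with a down step. -/
def downSum (m x y : ℕ) : R :=
  ∑ P : Fin m → Bool with CompletesDyck x y P,
    (if StartsUp P then a ^ x * b ^ y * t else 1) * valleyWeight a b t x y P

lemma sum_bool_words {M : Type*} [AddCommMonoid M] {m : ℕ} (f : (Fin (m + 1) → Bool) → M) :
    ∑ P, f P = ∑ P : Fin m → Bool, f (Fin.cons true P) +
      ∑ P : Fin m → Bool, f (Fin.cons false P) := by
  rw [← (Fin.consEquiv fun _ : Fin (m + 1) => Bool).sum_comp, Fintype.sum_prod_type,
    Fintype.sum_bool]
  rfl

lemma upSum_succ {m x y : ℕ} (hxy : y ≤ x) :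
    upSum a b t (m + 1) x y = upSum a b t m (x + 1) y + downSum a b t m x (y + 1) := by
  simp only [upSum, downSum, sum_filter, sum_bool_words, completesDyck_cons hxy, valleyWeight_cons]
  simp

lemma startsUp_cons {m : ℕ} (c : Bool) (P : Fin m → Bool) :
    StartsUp (Fin.cons c P : Fin (m + 1) → Bool) ↔ c = true :=
  ⟨fun ⟨_, e⟩ => e, fun e => ⟨Nat.succ_pos m, e⟩⟩

lemma downSum_succ {m x y : ℕ} (hxy : y ≤ x) :
    downSum a b t (m + 1) x y =
      a ^ x * b ^ y * t * upSum a b t m (x + 1) y + downSum a b t m x (y + 1) := by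
  simp only [upSum, downSum, sum_filter, sum_bool_words, completesDyck_cons hxy, valleyWeight_cons,
    startsUp_cons, mul_sum]
  simp

lemma upSum_eq_zero {m x y : ℕ} (h : y + m < x) : upSum a b t m x y = 0 := by
  rw [upSum, filter_false_of_mem fun P _ hP => by have := hP.le_add; omega, sum_empty]

lemma downSum_eq_zero {m x y : ℕ} (h : x < y) : downSum a b t m x y = 0 := by
  rw [downSum, filter_false_of_mem fun P _ hP => by have := hP.le; omega, sum_empty]

lemma upSum_zero (x : ℕ) : upSum a b t 0 x x = 1 := by
  simp [upSum, CompletesDyck, UpCt, DownCt, valleyWeight, Valleys]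

lemma downSum_zero (x : ℕ) : downSum a b t 0 x x = 1 := by
  simp [downSum, CompletesDyck, UpCt, DownCt, valleyWeight, Valleys, StartsUp]

lemma downSum_all_down (g y : ℕ) : downSum a b t g (y + g) y = 1 := by
  induction g generalizing y with
  | zero => exact downSum_zero a b t y
  | succ g ih =>
    rw [downSum_succ a b t (by omega), upSum_eq_zero a b t (by omega),
      show y + (g + 1) = y + 1 + g by ring, ih, mul_zero, zero_add]

lemma downSum_of_upSum {L : ℕ}
    (h : ∀ g y, upSum a b t (2 * L + g + 1) (y + g + 1) y = motzkinSubsetSum a b t L g y 1)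
    (g y : ℕ) : downSum a b t (2 * L + g + 2) (y + 1 + g) (y + 1) =
      a ^ (y + 1 + g) * motzkinSubsetSum a b t L (g + 1) y 0 := by
  induction g generalizing y with
  | zero =>
    rw [downSum_succ a b t (by omega), downSum_eq_zero a b t (by omega), h 0 (y + 1)]
    simp only [motzkinSubsetSum, motzkinSum_zero_height]
    ring
  | succ g ih =>
    rw [downSum_succ a b t (by omega), h, motzkinSubsetSum_gap_succ a b t L (g + 1),
      show y + 1 + (g + 1) = y + 1 + 1 + g by ring,
      show 2 * L + (g + 1) + 1 = 2 * L + g + 2 by ring, ih]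
    ring

lemma upSum_eq_motzkinSubsetSum (L g y : ℕ) :
    upSum a b t (2 * L + g + 1) (y + g + 1) y = motzkinSubsetSum a b t L g y 1 := by
  induction L generalizing g y with
  | zero =>
    rw [upSum_succ a b t (by omega), upSum_eq_zero a b t (by omega),
      show y + g + 1 = y + 1 + g by ring, show 2 * 0 + g = g by ring, downSum_all_down,
      motzkinSubsetSum_zero_one, zero_add]
  | succ L ih =>
    rw [upSum_succ a b t (by omega), motzkinSubsetSum_succ, ← ih,
      show y + g + 1 = y + 1 + g by ring,
      show 2 * (L + 1) + g = 2 * L + g + 2 by ring, downSum_of_upSum a b t ih]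
    congr 2
    ring

lemma upSum_eq_motzkinSum (n : ℕ) :
    upSum a b t (2 * n) 0 0 = motzkinSum a b t (n - 1) 0 1 := by
  cases n with
  | zero => simpa [motzkinSum] using upSum_zero a b t 0
  | succ n =>
    have h := upSum_eq_motzkinSubsetSum a b t n 0 0
    rw [show 2 * (n + 1) = 2 * n + 1 + 1 by ring, upSum_succ a b t le_rfl,
      downSum_eq_zero a b t (by omega), add_zero]
    simpa [motzkinSubsetSum] using h

end Words

lemma CPoly_eq_motzkinSum (n : ℕ) :
    CPoly n = motzkinSum (X 0) (X 1) (X 2 : MvPolynomial (Fin 3) ℤ) (n - 1) 0 1 := by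
  rw [← upSum_eq_motzkinSum, CPoly, upSum, DyckSet]
  simp only [completesDyck_zero_zero]
  refine sum_congr rfl fun P _ => ?_
  simp only [valleyWeight, zero_add, prod_mul_distrib, prod_pow_eq_pow_sum, prod_const]
  rfl

lemma subT3_CPoly (u : MvPolynomial (Fin 3) ℤ) (n : ℕ) :
    subT3 u (CPoly n) = motzkinSum (X 0) (X 1) u (n - 1) 0 1 := by
  rw [CPoly_eq_motzkinSum, subT3]
  refine (map_motzkinSum (X 0) (X 1) (X 2)
    (bind₁ fun i : Fin 3 => if i = 2 then u else X i).toRingHom (n - 1) 0 1).trans ?_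
  simp

lemma subT3_pow_CPoly (s n : ℕ) :
    subT3 ((X 0 * X 1) ^ s * X 2) (CPoly n) =
      motzkinSum (X 0) (X 1) (X 2 : MvPolynomial (Fin 3) ℤ) (n - 1) s 1 := by
  rw [subT3_CPoly]
  simpa using (motzkinSum_add (X 0) (X 1) (X 2 : MvPolynomial (Fin 3) ℤ) s (n - 1) 0 0).symm

/-- Fürlinger–Hofbauer recursion,
`C_n(a,b;t) = C_{n-1}(a,b;abt) + bt Σ_{k=0}^{n-2} a^{k+1} C_k(a,b;abt) C_{n-k-1}(a,b;(ab)^{k+1}t)`. -/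
theorem stmt3 (n : ℕ) (hn : 1 ≤ n) :
    CPoly n = subT3 (X 0 * X 1 * X 2) (CPoly (n - 1)) +
      X 1 * X 2 * ∑ k ∈ Finset.range (n - 1),
        X 0 ^ (k + 1) * subT3 (X 0 * X 1 * X 2) (CPoly k) *
          subT3 ((X 0 * X 1) ^ (k + 1) * X 2) (CPoly (n - k - 1)) := by
  have hsub (m : ℕ) : subT3 (X 0 * X 1 * X 2) (CPoly m) =
      motzkinSum (X 0) (X 1) (X 2 : MvPolynomial (Fin 3) ℤ) (m - 1) 1 1 := by
    simpa using subT3_pow_CPoly 1 m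
  simp only [hsub, subT3_pow_CPoly]
  rw [CPoly_eq_motzkinSum]
  obtain _ | _ | n := n
  · omega
  · simp [motzkinSum]
  · rw [show n + 1 + 1 - 1 = n + 1 by omega, show n + 1 - 1 = n by omega, sum_range_succ',
      motzkinSum_succ, motzkinSum_first_passage, motzkinSum_zero_height]
    have e (i : ℕ) : n + 1 + 1 - (i + 1) - 1 - 1 = n - 1 - i := by omega
    have e' (i : ℕ) : 0 + 1 + i + 1 = i + 1 + 1 := by ring
    simp only [e, e', Nat.add_sub_cancel, Nat.sub_zero, Nat.zero_sub]
    rw [sum_congr rfl fun i _ => by rw [mul_left_comm, ← mul_assoc]]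
    simp only [motzkinSum, zero_add, if_true]
    ring
end

section
/- For every integer n ≥ 1, C_n(a,b;t) = C_{n-1}(a,b;t) + a^{n-1}·t·Σ_{k=1}^{n-1} b^{k} C_k(a,b;t) C_{n-k-1}(a,b;(ab)^{k}t), as an identity of polynomials in ℤ[a,b,t], where C_m(a,b;u) denotes the polynomial C_m(a,b;t) with t replaced by u. -/
open Finset MvPolynomial

section MotzkinPolynomials

/-- A step at level `x` of a sequence indexed by heights: either stay, or go down by one
with weight `a ^ x * t`. -/
noncomputable def downStep (x : ℕ) (f : ℕ → MvPolynomial (Fin 3) ℤ) (h : ℕ) :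
    MvPolynomial (Fin 3) ℤ :=
  f h + X 0 ^ x * X 2 * f (h + 1)

/-- Shift of a sequence indexed by heights up by one. -/
noncomputable def upShift (f : ℕ → MvPolynomial (Fin 3) ℤ) : ℕ → MvPolynomial (Fin 3) ℤ
  | 0 => 0
  | h + 1 => f h

/-- The weighted sum over the bicoloured Motzkin paths of length `m` ending at height `h`, where
the `i`-th step has weight `b ^ i` (up), `a ^ i * t` (down), `1` or `(a * b) ^ i * t` (level). -/
noncomputable def motzkinPoly : ℕ → ℕ → MvPolynomial (Fin 3) ℤ
  | 0 => fun h => if h = 0 then 1 else 0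
  | m + 1 => downStep (m + 1)
      (fun h => motzkinPoly m h + X 1 ^ (m + 1) * upShift (motzkinPoly m) h)

/-- The composition of `downStep y, …, downStep (y + d - 1)`. -/
noncomputable def downSteps (y : ℕ) :
    ℕ → (ℕ → MvPolynomial (Fin 3) ℤ) → ℕ → MvPolynomial (Fin 3) ℤ
  | 0, f => f
  | d + 1, f => downStep (y + d) (downSteps y d f)

lemma downSteps_succ_left (y d : ℕ) (f : ℕ → MvPolynomial (Fin 3) ℤ) :
    downSteps (y + 1) d (downStep y f) = downSteps y (d + 1) f := by
  induction d with
  | zero => rfl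
  | succ d ih =>
    rw [downSteps, ih, show y + 1 + d = y + (d + 1) by ring]
    rfl

lemma downSteps_add_mul (y d : ℕ) (c : MvPolynomial (Fin 3) ℤ)
    (f g : ℕ → MvPolynomial (Fin 3) ℤ) (h : ℕ) :
    downSteps y d (fun h => f h + c * g h) h = downSteps y d f h + c * downSteps y d g h := by
  induction d generalizing h with
  | zero => rfl
  | succ d ih => simp only [downSteps, downStep, ih]; ring

lemma downSteps_upShift_succ (y d : ℕ) (f : ℕ → MvPolynomial (Fin 3) ℤ) (h : ℕ) :
    downSteps y d (upShift f) (h + 1) = downSteps y d f h := by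
  induction d generalizing h with
  | zero => rfl
  | succ d ih => simp only [downSteps, downStep, ih]

lemma subT3_X_zero (u : MvPolynomial (Fin 3) ℤ) : subT3 u (X 0) = X 0 := by simp [subT3]

lemma subT3_X_one (u : MvPolynomial (Fin 3) ℤ) : subT3 u (X 1) = X 1 := by simp [subT3]

lemma subT3_X_two (u : MvPolynomial (Fin 3) ℤ) : subT3 u (X 2) = u := by simp [subT3]

lemma subT3_motzkinPoly_succ (u : MvPolynomial (Fin 3) ℤ) (m h : ℕ) :
    subT3 u (motzkinPoly (m + 1) h) =
      subT3 u (motzkinPoly m h) + X 1 ^ (m + 1) * subT3 u (upShift (motzkinPoly m) h) +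
        X 0 ^ (m + 1) * u * (subT3 u (motzkinPoly m (h + 1)) +
          X 1 ^ (m + 1) * subT3 u (motzkinPoly m h)) := by
  have h0 := subT3_X_zero u
  have h1 := subT3_X_one u
  have h2 := subT3_X_two u
  simp only [subT3] at h0 h1 h2 ⊢
  simp only [motzkinPoly, downStep, upShift, map_add, map_mul, map_pow, h0, h1, h2]

lemma motzkinPoly_succ_zero (m : ℕ) :
    motzkinPoly (m + 1) 0 = motzkinPoly m 0 +
      X 0 ^ (m + 1) * X 2 * (motzkinPoly m 1 + X 1 ^ (m + 1) * motzkinPoly m 0) := by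
  rw [motzkinPoly, downStep, upShift, upShift, mul_zero, add_zero]

/-- Decomposition of a path ending at a positive height at its last step leaving the axis. -/
lemma motzkinPoly_succ_height (m h : ℕ) :
    motzkinPoly m (h + 1) = ∑ j ∈ range m, motzkinPoly j 0 * X 1 ^ ((j + 1) * (h + 1)) *
      subT3 ((X 0 * X 1) ^ (j + 1) * X 2) (motzkinPoly (m - 1 - j) h) := by
  induction m generalizing h with
  | zero => simp [motzkinPoly]
  | succ m ih =>
    have key : ∀ j ∈ range m, motzkinPoly j 0 * X 1 ^ ((j + 1) * (h + 1)) *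
        subT3 ((X 0 * X 1) ^ (j + 1) * X 2) (motzkinPoly (m + 1 - 1 - j) h) =
        motzkinPoly j 0 * X 1 ^ ((j + 1) * (h + 1)) *
          subT3 ((X 0 * X 1) ^ (j + 1) * X 2) (motzkinPoly (m - 1 - j) h) +
        X 1 ^ (m + 1) * (motzkinPoly j 0 * X 1 ^ ((j + 1) * h) *
          subT3 ((X 0 * X 1) ^ (j + 1) * X 2) (upShift (motzkinPoly (m - 1 - j)) h)) +
        X 0 ^ (m + 1) * X 2 * (motzkinPoly j 0 * X 1 ^ ((j + 1) * (h + 1 + 1)) *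
          subT3 ((X 0 * X 1) ^ (j + 1) * X 2) (motzkinPoly (m - 1 - j) (h + 1))) +
        X 0 ^ (m + 1) * X 2 * X 1 ^ (m + 1) * (motzkinPoly j 0 * X 1 ^ ((j + 1) * (h + 1)) *
          subT3 ((X 0 * X 1) ^ (j + 1) * X 2) (motzkinPoly (m - 1 - j) h)) := by
      intro j hj
      obtain ⟨d, rfl⟩ : ∃ d, m = d + 1 + j := ⟨m - 1 - j, by have := mem_range.1 hj; omega⟩
      rw [show d + 1 + j + 1 - 1 - j = d + 1 by omega, show d + 1 + j - 1 - j = d by omega,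
        subT3_motzkinPoly_succ]
      ring
    rw [sum_range_succ, sum_congr rfl key]
    simp only [sum_add_distrib, ← mul_sum, ← ih]
    have last : subT3 ((X 0 * X 1) ^ (m + 1) * X 2) (motzkinPoly (m + 1 - 1 - m) h) =
        if h = 0 then 1 else 0 := by
      rw [show m + 1 - 1 - m = 0 by omega]
      by_cases hh : h = 0 <;> simp [motzkinPoly, subT3, hh]
    rw [last]
    cases h with
    | zero =>
      have hz : ∀ u : MvPolynomial (Fin 3) ℤ, subT3 u 0 = 0 := fun u => by simp [subT3]
      simp only [motzkinPoly, downStep, upShift, hz]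
      simp
      ring
    | succ h =>
      simp only [upShift, ← ih]
      simp only [motzkinPoly, downStep, upShift]
      simp
      ring

end MotzkinPolynomials

section Words

/-- Every prefix of the word `P` has at least as many U's as D's. -/
def IsBallot {m : ℕ} (P : Fin m → Bool) : Prop := ∀ i, i ≤ m → DownCt P i ≤ UpCt P i

/-- The last letter of `P` exists and is a D. -/
def EndsDown {m : ℕ} (P : Fin m → Bool) : Prop := ∃ j : Fin m, j.val + 1 = m ∧ P j = false

/-- The monomial `a ^ α(P) * b ^ β(P) * t ^ des P`. -/
noncomputable def pathWeight {m : ℕ} (P : Fin m → Bool) : MvPolynomial (Fin 3) ℤ :=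
  X 0 ^ alphaPath P * X 1 ^ betaPath P * X 2 ^ desPath P

variable {m : ℕ} (P : Fin m → Bool) (c : Bool)

/-- The word `P` followed by the letter `c`. -/
def appendLetter : Fin (m + 1) → Bool := Fin.snoc (α := fun _ => Bool) P c

lemma appendLetter_castSucc (j : Fin m) : appendLetter P c j.castSucc = P j :=
  Fin.snoc_castSucc (α := fun _ => Bool) c P j

lemma appendLetter_last : appendLetter P c (Fin.last m) = c :=
  Fin.snoc_last (α := fun _ => Bool) c P

lemma upCt_appendLetter (i : ℕ) :
    UpCt (appendLetter P c) i =
      UpCt P i + if m < i ∧ c = true then 1 else 0 := by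
  simp only [UpCt, card_filter, Fin.sum_univ_castSucc, appendLetter_castSucc, appendLetter_last,
    Fin.val_castSucc, Fin.val_last]

lemma downCt_appendLetter (i : ℕ) :
    DownCt (appendLetter P c) i =
      DownCt P i + if m < i ∧ c = false then 1 else 0 := by
  simp only [DownCt, card_filter, Fin.sum_univ_castSucc, appendLetter_castSucc, appendLetter_last,
    Fin.val_castSucc, Fin.val_last]

lemma upCt_succ_length : UpCt P (m + 1) = UpCt P m := by
  unfold UpCt; exact congrArg card (filter_congr fun j _ => by simp [Nat.lt_succ_of_lt j.isLt])

lemma downCt_succ_length : DownCt P (m + 1) = DownCt P m := by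
  unfold DownCt; exact congrArg card (filter_congr fun j _ => by simp [Nat.lt_succ_of_lt j.isLt])

open Classical in
lemma sum_valleys_appendLetter (g : ℕ → ℕ) :
    ∑ j ∈ Valleys (appendLetter P c), g (j.val + 1) =
      ∑ j ∈ Valleys P, g (j.val + 1) + if c = true ∧ EndsDown P then g m else 0 := by
  have hlast : (if c = true ∧ EndsDown P then g m else 0) =
      ∑ j : Fin m, if j.val + 1 = m ∧ P j = false ∧ c = true then g (j.val + 1) else 0 := by
    by_cases h : EndsDown P
    · obtain ⟨j, hj, hP⟩ := id h
      rw [sum_eq_single j]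
      · simp [h, hj, hP]
      · intro i _ hij
        rw [if_neg]
        rintro ⟨hi, -⟩
        exact hij (Fin.ext (by omega))
      · simp
    · rw [if_neg (by tauto), eq_comm]
      refine sum_eq_zero fun j _ => if_neg ?_
      rintro ⟨hj, hP, -⟩
      exact h ⟨j, hj, hP⟩
  rw [hlast]
  simp only [Valleys, sum_filter, Fin.sum_univ_castSucc, appendLetter_castSucc, appendLetter_last,
    Fin.val_castSucc, Fin.val_last, lt_irrefl, IsEmpty.exists_iff, and_false, if_false, add_zero,
    ← sum_add_distrib]
  refine sum_congr rfl fun j _ => ?_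
  by_cases hj : j.val + 1 < m
  · have hs : (appendLetter P c) ⟨j.val + 1, by omega⟩ = P ⟨j.val + 1, hj⟩ :=
      appendLetter_castSucc P c ⟨j.val + 1, hj⟩
    simp [hs, hj, hj.ne]
  · have hm : j.val + 1 = m := by omega
    have hs : (appendLetter P c) ⟨j.val + 1, by omega⟩ = c := by
      rw [show (⟨j.val + 1, by omega⟩ : Fin (m + 1)) = Fin.last m from Fin.ext hm]
      exact appendLetter_last P c
    simp only [hs]
    simp [hm]

lemma endsDown_appendLetter : EndsDown (appendLetter P c) ↔ c = false := by
  constructor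
  · rintro ⟨j, hj, h⟩
    rwa [show j = Fin.last m from Fin.ext (by simpa using hj), appendLetter_last] at h
  · exact fun h => ⟨Fin.last m, rfl, by rwa [appendLetter_last]⟩

open Classical in
lemma pathWeight_appendLetter :
    pathWeight (appendLetter P c) = pathWeight P *
      if c = true ∧ EndsDown P then X 0 ^ UpCt P m * X 1 ^ DownCt P m * X 2 else 1 := by
  have hα := sum_valleys_appendLetter P c (UpCt (appendLetter P c))
  have hβ := sum_valleys_appendLetter P c (DownCt (appendLetter P c))
  have hδ := sum_valleys_appendLetter P c (fun _ => 1)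
  have hU : ∀ i, i ≤ m → UpCt (appendLetter P c) i = UpCt P i := fun i hi => by
    simp [upCt_appendLetter, hi.not_gt]
  have hD : ∀ i, i ≤ m → DownCt (appendLetter P c) i = DownCt P i :=
    fun i hi => by simp [downCt_appendLetter, hi.not_gt]
  rw [hU m le_rfl, sum_congr (s₁ := Valleys P) rfl
    (fun j _ => hU (j.val + 1) (Nat.succ_le_of_lt j.isLt))] at hα
  rw [hD m le_rfl, sum_congr (s₁ := Valleys P) rfl
    (fun j _ => hD (j.val + 1) (Nat.succ_le_of_lt j.isLt))] at hβ
  rw [← card_eq_sum_ones, ← card_eq_sum_ones] at hδ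
  simp only [pathWeight, alphaPath, betaPath, desPath, hα, hβ, hδ]
  split_ifs <;> ring

lemma isBallot_appendLetter : IsBallot (appendLetter P c) ↔
    IsBallot P ∧ (c = false → DownCt P m + 1 ≤ UpCt P m) := by
  constructor
  · refine fun h => ⟨fun i hi => ?_, fun hc => ?_⟩
    · simpa [upCt_appendLetter, downCt_appendLetter, hi.not_gt] using h i (by omega)
    · simpa [upCt_appendLetter, downCt_appendLetter, hc, upCt_succ_length, downCt_succ_length]
        using h (m + 1) le_rfl
  · rintro ⟨h, hc⟩ i hi
    rcases hi.lt_or_eq with hi | rfl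
    · have := h i (by omega)
      simpa [upCt_appendLetter, downCt_appendLetter, show ¬ m < i by omega] using this
    · have := h m le_rfl
      cases c <;>
        simp [upCt_appendLetter, downCt_appendLetter, upCt_succ_length, downCt_succ_length] at hc ⊢ <;>
        omega

lemma sum_words_succ {A : Type*} [AddCommMonoid A] (f : (Fin (m + 1) → Bool) → A) :
    ∑ Q, f Q = ∑ P : Fin m → Bool, (f (appendLetter P true) + f (appendLetter P false)) := by
  rw [← (Fin.snocEquiv (fun _ : Fin (m + 1) => Bool)).sum_comp, Fintype.sum_prod_type_right]
  simp [Fin.snocEquiv, appendLetter]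

end Words

section BallotSums

open Classical in
/-- The weighted sum over the ballot words of length `m` with `x` letters U and `y` letters D
whose last letter is D. -/
noncomputable def ballotSumDown (m x y : ℕ) : MvPolynomial (Fin 3) ℤ :=
  ∑ P : Fin m → Bool,
    if IsBallot P ∧ UpCt P m = x ∧ DownCt P m = y ∧ EndsDown P then pathWeight P else 0

open Classical in
/-- The weighted sum over the ballot words of length `m` with `x` letters U and `y` letters D
whose last letter is not D. -/
noncomputable def ballotSumUp (m x y : ℕ) : MvPolynomial (Fin 3) ℤ :=
  ∑ P : Fin m → Bool,
    if IsBallot P ∧ UpCt P m = x ∧ DownCt P m = y ∧ ¬ EndsDown P then pathWeight P else 0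

lemma ballotSumUp_eq_zero {m x y : ℕ} (h : x < y) : ballotSumUp m x y = 0 := by
  refine sum_eq_zero fun P _ => if_neg ?_
  rintro ⟨hP, hx, hy, -⟩
  have := hP m le_rfl
  omega

lemma ballotSumDown_eq_zero {m x y : ℕ} (h : x < y) : ballotSumDown m x y = 0 := by
  refine sum_eq_zero fun P _ => if_neg ?_
  rintro ⟨hP, hx, hy, -⟩
  have := hP m le_rfl
  omega

lemma ballotSumDown_zero_right (m x : ℕ) : ballotSumDown m x 0 = 0 := by
  refine sum_eq_zero fun P _ => if_neg ?_
  rintro ⟨-, -, hy, j, -, hP⟩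
  have : j ∈ univ.filter (fun j : Fin m => j.val < m ∧ P j = false) := by simp [hP]
  rw [card_eq_zero.1 hy] at this
  simp at this

open Classical in
lemma ballotSumDown_succ {m x y : ℕ} (h : y + 1 ≤ x) :
    ballotSumDown (m + 1) x (y + 1) = ballotSumDown m x y + ballotSumUp m x y := by
  unfold ballotSumDown ballotSumUp
  rw [sum_words_succ, ← sum_add_distrib]
  refine sum_congr rfl fun P _ => ?_
  have ht : ¬ (IsBallot (appendLetter P true) ∧ UpCt (appendLetter P true) (m + 1) = x ∧
      DownCt (appendLetter P true) (m + 1) = y + 1 ∧ EndsDown (appendLetter P true)) := by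
    simp [endsDown_appendLetter]
  have hf : (IsBallot (appendLetter P false) ∧ UpCt (appendLetter P false) (m + 1) = x ∧
      DownCt (appendLetter P false) (m + 1) = y + 1 ∧ EndsDown (appendLetter P false)) ↔
      IsBallot P ∧ UpCt P m = x ∧ DownCt P m = y := by
    simp [isBallot_appendLetter, upCt_appendLetter, downCt_appendLetter, endsDown_appendLetter,
      upCt_succ_length, downCt_succ_length]
    grind
  rw [if_neg ht, if_congr hf (pathWeight_appendLetter P false) rfl]
  by_cases hE : EndsDown P <;> simp [hE]

open Classical in
lemma ballotSumUp_succ (m x y : ℕ) :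
    ballotSumUp (m + 1) (x + 1) y =
      ballotSumUp m x y + X 0 ^ x * X 1 ^ y * X 2 * ballotSumDown m x y := by
  unfold ballotSumDown ballotSumUp
  rw [sum_words_succ, mul_sum, ← sum_add_distrib]
  refine sum_congr rfl fun P _ => ?_
  have hf : ¬ (IsBallot (appendLetter P false) ∧ UpCt (appendLetter P false) (m + 1) = x + 1 ∧
      DownCt (appendLetter P false) (m + 1) = y ∧ ¬ EndsDown (appendLetter P false)) := by
    simp [endsDown_appendLetter]
  have ht : (IsBallot (appendLetter P true) ∧ UpCt (appendLetter P true) (m + 1) = x + 1 ∧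
      DownCt (appendLetter P true) (m + 1) = y ∧ ¬ EndsDown (appendLetter P true)) ↔
      IsBallot P ∧ UpCt P m = x ∧ DownCt P m = y := by
    simp [isBallot_appendLetter, upCt_appendLetter, downCt_appendLetter, endsDown_appendLetter,
      upCt_succ_length, downCt_succ_length]
  rw [if_neg hf, if_congr ht (pathWeight_appendLetter P true) rfl]
  by_cases hP : IsBallot P ∧ UpCt P m = x ∧ DownCt P m = y
  · obtain ⟨hB, rfl, rfl⟩ := hP
    by_cases hE : EndsDown P <;> simp [hB, hE, mul_comm]
  · rw [if_neg hP, if_neg (by tauto), if_neg (by tauto)]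
    simp

lemma isBallot_of_length_zero (P : Fin 0 → Bool) : IsBallot P := by
  intro i _; simp [UpCt, DownCt]

lemma ballotSumUp_zero_right (x : ℕ) : ballotSumUp x x 0 = 1 := by
  induction x with
  | zero =>
    simp [ballotSumUp, isBallot_of_length_zero, EndsDown, pathWeight, alphaPath, betaPath, desPath,
      Valleys, UpCt, DownCt]
  | succ x ih => rw [ballotSumUp_succ, ih, ballotSumDown_zero_right]; simp

lemma ballotSums_eq_downSteps (m y d : ℕ) (hm : y + 1 + d + (y + 1) = m) :
    ballotSumDown m (y + 1 + d) (y + 1) = downSteps (y + 1) d (motzkinPoly y) 0 ∧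
    ballotSumUp m (y + 1 + d) (y + 1) =
      X 1 ^ (y + 1) * downSteps (y + 1) d (upShift (motzkinPoly y)) 0 := by
  induction m generalizing y d with
  | zero => omega
  | succ m ih =>
    constructor
    · rw [ballotSumDown_succ (by omega)]
      cases y with
      | zero =>
        have hm' : m = 0 + 1 + d := by omega
        rw [ballotSumDown_zero_right, hm', ballotSumUp_zero_right]
        have : ∀ d h, downSteps 1 d (motzkinPoly 0) h = if h = 0 then 1 else 0 := by
          intro d
          induction d with
          | zero => intro h; rfl
          | succ d ih => intro h; simp [downSteps, downStep, ih]
        simp [this]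
      | succ y =>
        obtain ⟨h1, h2⟩ := ih y (d + 1) (by omega)
        rw [show y + 1 + 1 + d = y + 1 + (d + 1) by ring, h1, h2, motzkinPoly,
          downSteps_succ_left, downSteps_add_mul]
    · cases d with
      | zero =>
        rw [add_zero, ballotSumUp_succ, ballotSumUp_eq_zero (by omega),
          ballotSumDown_eq_zero (by omega)]
        simp [downSteps, upShift]
      | succ d =>
        obtain ⟨h1, h2⟩ := ih y d (by omega)
        rw [← add_assoc, ballotSumUp_succ, h1, h2, downSteps, downStep, downSteps_upShift_succ]
        ring

open Classical in
lemma CPoly_eq_ballotSums (n : ℕ) :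
    CPoly n = ballotSumDown (2 * n) n n + ballotSumUp (2 * n) n n := by
  unfold CPoly DyckSet ballotSumDown ballotSumUp
  rw [sum_filter, ← sum_add_distrib]
  refine sum_congr rfl fun P _ => ?_
  have hlen : UpCt P (2 * n) + DownCt P (2 * n) = 2 * n := by
    have h := card_filter_add_card_filter_not (s := (univ : Finset (Fin (2 * n))))
      (fun j => P j = true)
    simpa [UpCt, DownCt] using h
  have hiff : IsDyck P ↔ IsBallot P ∧ UpCt P (2 * n) = n ∧ DownCt P (2 * n) = n := by
    unfold IsDyck IsBallot
    refine and_congr_right fun _ => ?_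
    omega
  simp only [hiff]
  by_cases hB : IsBallot P ∧ UpCt P (2 * n) = n ∧ DownCt P (2 * n) = n
  · by_cases hE : EndsDown P <;> simp [hB, hE, pathWeight]
  · rw [if_neg hB, if_neg (by tauto), if_neg (by tauto), add_zero]

lemma CPoly_zero : CPoly 0 = 1 := by
  rw [CPoly_eq_ballotSums, ballotSumDown_zero_right, zero_add]
  exact ballotSumUp_zero_right 0

lemma CPoly_succ (n : ℕ) : CPoly (n + 1) = motzkinPoly n 0 := by
  obtain ⟨h1, h2⟩ := ballotSums_eq_downSteps (2 * (n + 1)) n 0 (by ring)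
  rw [add_zero] at h1 h2
  rw [CPoly_eq_ballotSums, h1, h2]
  simp [downSteps, upShift]

lemma sum_CPoly_eq_motzkinPoly (m : ℕ) :
    ∑ k ∈ Finset.Icc 1 (m + 1), X 1 ^ k * CPoly k *
        subT3 ((X 0 * X 1) ^ k * X 2) (CPoly (m + 1 + 1 - k - 1)) =
      motzkinPoly m 1 + X 1 ^ (m + 1) * motzkinPoly m 0 := by
  rw [← Finset.Ico_add_one_right_eq_Icc, sum_Ico_eq_sum_range,
    show m + 1 + 1 - 1 = m + 1 by omega, sum_range_succ, motzkinPoly_succ_height m 0]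
  refine congrArg₂ (· + ·) (sum_congr rfl fun j hj => ?_) ?_
  · have := mem_range.1 hj
    rw [show m + 1 + 1 - (1 + j) - 1 = m - 1 - j + 1 by omega, add_comm 1 j, CPoly_succ,
      CPoly_succ, zero_add, mul_one, mul_comm (X 1 ^ (j + 1))]
  · rw [show m + 1 + 1 - (1 + m) - 1 = 0 by omega, add_comm 1 m, CPoly_succ, CPoly_zero, subT3,
      map_one, mul_one]

end BallotSums

/-- last-peak recursion,
`C_n(a,b;t) = C_{n-1}(a,b;t) + a^{n-1} t Σ_{k=1}^{n-1} b^k C_k(a,b;t) C_{n-k-1}(a,b;(ab)^k t)`. -/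
theorem stmt4 (n : ℕ) (hn : 1 ≤ n) :
    CPoly n = CPoly (n - 1) +
      X 0 ^ (n - 1) * X 2 * ∑ k ∈ Finset.Icc 1 (n - 1),
        X 1 ^ k * CPoly k * subT3 ((X 0 * X 1) ^ k * X 2) (CPoly (n - k - 1)) := by
  obtain ⟨n, rfl⟩ : ∃ m, n = m + 1 := ⟨n - 1, by omega⟩
  cases n with
  | zero => simp [CPoly_succ, CPoly_zero, motzkinPoly]
  | succ m =>
    rw [Nat.add_sub_cancel, sum_CPoly_eq_motzkinPoly, CPoly_succ, CPoly_succ,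
      motzkinPoly_succ_zero]
end

section
/- For every integer n ≥ 1, the statistics (spea, npea) and (stun, n−des) are equidistributed over Dyck paths: Σ_{P∈D_n} q^{spea P} t^{npea P} = Σ_{P∈D_n} q^{stun P} t^{n−des P}, as an identity in ℤ[q,t]. -/
open Finset MvPolynomial

/-- A power series that equals `X` times a combination of itself and its rescaling vanishes. -/
theorem eq_zero_of_eq_X_mul {R : Type*} [CommRing R] (q : R) (d a b : PowerSeries R)
    (h : d = PowerSeries.X * (a * d + b * PowerSeries.rescale q d)) : d = 0 := by
  ext n
  induction n using Nat.strong_induction_on with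
  | _ n ih =>
    rw [h]
    cases n with
    | zero => simp
    | succ n =>
      rw [PowerSeries.coeff_succ_X_mul, map_add, PowerSeries.coeff_mul, PowerSeries.coeff_mul, map_zero,
        Finset.sum_eq_zero, Finset.sum_eq_zero, add_zero]
      · intro p hp
        rw [HasAntidiagonal.mem_antidiagonal] at hp
        rw [PowerSeries.coeff_rescale, ih p.2 (by omega)]
        simp
      · intro p hp
        rw [HasAntidiagonal.mem_antidiagonal] at hp
        rw [ih p.2 (by omega)]
        simp

/-- A family solving the `x`-rescaling equation also solves the `t`-rescaling equation. -/
theorem eq_of_rescale_eq {R : Type*} [CommRing R] (q t : R) (g g₁ : PowerSeries R)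
    (hg : g = 1 + PowerSeries.X * PowerSeries.C t * g +
      PowerSeries.C q * PowerSeries.X * PowerSeries.rescale q g * (g - 1))
    (hg₁ : g₁ = 1 + PowerSeries.X * PowerSeries.C (q * t) * g₁ +
      PowerSeries.C q * PowerSeries.X * PowerSeries.rescale q g₁ * (g₁ - 1)) :
    g = 1 + PowerSeries.X * (g₁ - 1 + PowerSeries.C t) * g := by
  have key : 1 - g * (1 + PowerSeries.X - PowerSeries.C t * PowerSeries.X
      - PowerSeries.X * g₁) = 0 := by
    set d := 1 - g * (1 + PowerSeries.X - PowerSeries.C t * PowerSeries.X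
      - PowerSeries.X * g₁) with hd
    have hrd : PowerSeries.rescale q d = 1 - PowerSeries.rescale q g * (1 + PowerSeries.C q * PowerSeries.X
        - PowerSeries.C t * (PowerSeries.C q * PowerSeries.X)
        - PowerSeries.C q * PowerSeries.X * PowerSeries.rescale q g₁) := by
      have hC : PowerSeries.rescale q (PowerSeries.C t) = PowerSeries.C t := by
        ext n
        rw [PowerSeries.coeff_rescale, PowerSeries.coeff_C]
        split_ifs with h <;> simp [h]
      rw [hd]
      simp only [map_sub, map_mul, map_add, map_one, PowerSeries.rescale_X, hC]
    rw [map_mul] at hg₁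
    generalize PowerSeries.rescale q g = r at *
    generalize PowerSeries.rescale q g₁ = r₁ at *
    generalize PowerSeries.C q = Q at *
    generalize PowerSeries.C t = T at *
    refine eq_zero_of_eq_X_mul q d
      (Q * r + T + Q * r₁ + Q * T
        - PowerSeries.X * (Q * r + T) * (Q * r₁ + Q * T)) (Q * T * PowerSeries.X) ?_
    rw [hrd]
    have e₁ : g * (1 - Q * PowerSeries.X * r - T * PowerSeries.X)
        = 1 - Q * PowerSeries.X * r := by linear_combination hg
    have e₂ : g₁ * (1 - Q * PowerSeries.X * r₁ - Q * T * PowerSeries.X)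
        = 1 - Q * PowerSeries.X * r₁ := by linear_combination hg₁
    have e : d * ((1 - Q * PowerSeries.X * r - T * PowerSeries.X) *
        (1 - Q * PowerSeries.X * r₁ - Q * T * PowerSeries.X))
        = Q * T * PowerSeries.X ^ 2 * (1 - r * (1 + Q * PowerSeries.X
        - T * (Q * PowerSeries.X) - Q * PowerSeries.X * r₁)) := by
      rw [hd]
      linear_combination
        (-(1 + PowerSeries.X - T * PowerSeries.X) *
          (1 - Q * PowerSeries.X * r₁ - Q * T * PowerSeries.X)
          + PowerSeries.X * g₁ * (1 - Q * PowerSeries.X * r₁ - Q * T * PowerSeries.X)) * e₁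
        + PowerSeries.X * (1 - Q * PowerSeries.X * r) * e₂
    linear_combination e
  linear_combination -key

/-- The `t`-rescaling equation has at most one solution. -/
theorem unique_of_scale_eq {R : Type*} [CommRing R] (q : R) (f g : R → PowerSeries R)
    (hf : ∀ t, f t = 1 + PowerSeries.X * (f (q * t) - 1 + PowerSeries.C t) * f t)
    (hg : ∀ t, g t = 1 + PowerSeries.X * (g (q * t) - 1 + PowerSeries.C t) * g t) (t : R) :
    f t = g t := by
  ext n
  induction n using Nat.strong_induction_on generalizing t with
  | _ n ih =>
    rw [hf, hg]
    cases n with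
    | zero => simp
    | succ n =>
      simp only [mul_assoc, map_add, PowerSeries.coeff_succ_X_mul]
      rw [PowerSeries.coeff_mul, PowerSeries.coeff_mul]
      congr 1
      refine Finset.sum_congr rfl fun p hp => ?_
      rw [HasAntidiagonal.mem_antidiagonal] at hp
      simp only [map_sub, map_add]
      rw [ih p.1 (by omega), ih p.2 (by omega)]

namespace BinaryTree

/-- The generating series of a weight on binary trees, by number of nodes. -/
noncomputable def genSeries {R : Type*} [CommRing R] (w : BinaryTree Unit → R) : PowerSeries R :=
  PowerSeries.mk fun n => ∑ T ∈ treesOfNumNodesEq n, w T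

section genSeries

variable {R : Type*} [CommRing R]

theorem genSeries_add (u v : BinaryTree Unit → R) :
    genSeries (fun T => u T + v T) = genSeries u + genSeries v := by
  ext n
  simp [genSeries, Finset.sum_add_distrib]

theorem genSeries_sub (u v : BinaryTree Unit → R) :
    genSeries (fun T => u T - v T) = genSeries u - genSeries v := by
  ext n
  simp [genSeries, Finset.sum_sub_distrib]

theorem genSeries_const_mul (c : R) (u : BinaryTree Unit → R) :
    genSeries (fun T => c * u T) = PowerSeries.C c * genSeries u := by
  ext n
  simp [genSeries, Finset.mul_sum]

theorem genSeries_nil (c : R) :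
    genSeries (fun T => if T = nil then c else 0) = PowerSeries.C c := by
  ext n
  rw [genSeries, PowerSeries.coeff_mk, PowerSeries.coeff_C]
  split_ifs with h
  · simp [h]
  · refine Finset.sum_eq_zero fun T hT => if_neg ?_
    rintro rfl
    simp [mem_treesOfNumNodesEq] at hT
    exact h hT.symm

theorem genSeries_pow_numNodes (q : R) (u : BinaryTree Unit → R) :
    genSeries (fun T => q ^ T.numNodes * u T) = PowerSeries.rescale q (genSeries u) := by
  ext n
  rw [PowerSeries.coeff_rescale, genSeries, genSeries, PowerSeries.coeff_mk,
    PowerSeries.coeff_mk, Finset.mul_sum]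
  refine Finset.sum_congr rfl fun T hT => ?_
  rw [mem_treesOfNumNodesEq.1 hT]

theorem genSeries_node (w u v : BinaryTree Unit → R) (h₀ : w nil = 0)
    (h : ∀ A B, w (node () A B) = u A * v B) :
    genSeries w = PowerSeries.X * (genSeries u * genSeries v) := by
  ext n
  cases n with
  | zero => simp [genSeries, h₀]
  | succ n =>
    rw [PowerSeries.coeff_succ_X_mul, PowerSeries.coeff_mul, genSeries, PowerSeries.coeff_mk,
      treesOfNumNodesEq_succ, Finset.sum_biUnion]
    · refine Finset.sum_congr rfl fun p _ => ?_
      rw [genSeries, genSeries, PowerSeries.coeff_mk, PowerSeries.coeff_mk,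
        Finset.sum_mul_sum, ← Finset.sum_product', pairwiseNode, Finset.sum_map]
      exact Finset.sum_congr rfl fun x _ => h _ _
    · intro a _ b _ hab
      rw [Function.onFun, Finset.disjoint_left]
      intro T hTa hTb
      simp only [pairwiseNode, Finset.mem_map, Finset.mem_product, mem_treesOfNumNodesEq] at hTa hTb
      obtain ⟨x, ⟨hx₁, hx₂⟩, rfl⟩ := hTa
      obtain ⟨y, ⟨hy₁, hy₂⟩, hxy⟩ := hTb
      simp at hxy
      apply hab
      ext <;> grind

end genSeries

/-- The number of nodes without left child. -/
def leftEnds : BinaryTree Unit → ℕ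
  | nil => 0
  | node _ A B => (if A = nil then 1 else leftEnds A) + leftEnds B

/-- The sum over all nodes of the number of left ends in the left subtree. -/
def leftEndSum : BinaryTree Unit → ℕ
  | nil => 0
  | node _ A B => leftEndSum A + leftEnds A + leftEndSum B

/-- The number of nodes without right child. -/
def rightEnds : BinaryTree Unit → ℕ
  | nil => 0
  | node _ A B => rightEnds A + if B = nil then 1 else rightEnds B

/-- The number of nodes with a right child. -/
def rightEdges : BinaryTree Unit → ℕ
  | nil => 0
  | node _ A B => rightEdges A + rightEdges B + if B = nil then 0 else 1

/-- The sum, over the nodes with a right child, of one plus the size of the left subtree. -/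
def leftSizeSum : BinaryTree Unit → ℕ
  | nil => 0
  | node _ A B => leftSizeSum A + leftSizeSum B + if B = nil then 0 else numNodes A + 1

theorem rightEdges_add_rightEnds (T : BinaryTree Unit) :
    rightEdges T + rightEnds T = numNodes T := by
  induction T with
  | nil => rfl
  | node _ A B hA hB =>
    by_cases h : B = nil
    · subst h
      simp [rightEdges, rightEnds] at *
      omega
    · simp [rightEdges, rightEnds, h]
      omega

theorem genSeries_leftEnds {R : Type*} [CommRing R] (q t : R) :
    genSeries (fun T => q ^ leftEndSum T * t ^ leftEnds T) =
      1 + PowerSeries.X *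
        (genSeries (fun T => q ^ leftEndSum T * (q * t) ^ leftEnds T) - 1 + PowerSeries.C t) *
        genSeries (fun T => q ^ leftEndSum T * t ^ leftEnds T) := by
  have h := genSeries_node
    (fun T => q ^ leftEndSum T * t ^ leftEnds T - if T = nil then 1 else 0)
    (fun T => (q ^ leftEndSum T * (q * t) ^ leftEnds T - if T = nil then 1 else 0)
      + if T = nil then t else 0)
    (fun T => q ^ leftEndSum T * t ^ leftEnds T) (by simp [leftEndSum, leftEnds]) (by
      intro A B
      by_cases hA : A = nil
      · subst hA
        simp [leftEndSum, leftEnds]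
        ring
      · simp [leftEndSum, leftEnds, hA]
        ring)
  rw [genSeries_add, genSeries_sub, genSeries_sub, genSeries_nil, genSeries_nil, map_one] at h
  linear_combination h

theorem genSeries_rightEnds {R : Type*} [CommRing R] (q t : R) :
    genSeries (fun T => q ^ leftSizeSum T * t ^ rightEnds T) =
      1 + PowerSeries.X * PowerSeries.C t * genSeries (fun T => q ^ leftSizeSum T * t ^ rightEnds T)
      + PowerSeries.C q * PowerSeries.X *
        PowerSeries.rescale q (genSeries (fun T => q ^ leftSizeSum T * t ^ rightEnds T)) *
        (genSeries (fun T => q ^ leftSizeSum T * t ^ rightEnds T) - 1) := by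
  set w : BinaryTree Unit → R := fun T => q ^ leftSizeSum T * t ^ rightEnds T with hw
  have h₁ := genSeries_node
    (fun T => match T with
      | nil => 0
      | node _ A B => w A * if B = nil then t else 0) w
    (fun T => if T = nil then t else 0) rfl (fun _ _ => rfl)
  have h₂ := genSeries_node
    (fun T => w T - (if T = nil then 1 else 0) - match T with
      | nil => 0
      | node _ A B => w A * if B = nil then t else 0)
    (fun T => q * (q ^ numNodes T * w T)) (fun T => w T - if T = nil then 1 else 0)
    (by simp [hw, leftSizeSum, rightEnds]) (by
      intro A B
      by_cases hB : B = nil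
      · subst hB
        simp [hw, leftSizeSum, rightEnds]
        ring
      · simp [hw, leftSizeSum, rightEnds, hB]
        ring)
  rw [genSeries_sub, genSeries_sub, genSeries_const_mul, genSeries_pow_numNodes,
    genSeries_nil, h₁, genSeries_nil, map_one] at h₂
  linear_combination h₂

/-- The two pairs of statistics are equidistributed over binary trees with `n` nodes. -/
theorem sum_leftEnds_eq_sum_rightEnds {R : Type*} [CommRing R] (q t : R) (n : ℕ) :
    ∑ T ∈ treesOfNumNodesEq n, q ^ leftEndSum T * t ^ leftEnds T =
      ∑ T ∈ treesOfNumNodesEq n, q ^ leftSizeSum T * t ^ rightEnds T := by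
  have h := unique_of_scale_eq q
    (fun t => genSeries (fun T => q ^ leftEndSum T * t ^ leftEnds T))
    (fun t => genSeries (fun T => q ^ leftSizeSum T * t ^ rightEnds T))
    (genSeries_leftEnds q)
    (fun t => eq_of_rescale_eq q t _ _ (genSeries_rightEnds q t) (genSeries_rightEnds q (q * t))) t
  simpa [genSeries] using congrArg (PowerSeries.coeff n) h

end BinaryTree

theorem card_filter_lt_eq_count_take {m : ℕ} (P : Fin m → Bool) (b : Bool) (i : ℕ) :
    (univ.filter (fun j : Fin m => j.val < i ∧ P j = b)).card =
      ((List.ofFn P).take i).count b := by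
  induction m generalizing i with
  | zero => simp
  | succ m ih =>
    rw [Finset.card_filter, Fin.sum_univ_succ, List.ofFn_succ]
    cases i with
    | zero => simp
    | succ i =>
      have := ih (fun j => P j.succ) i
      rw [Finset.card_filter] at this
      rw [List.take_succ_cons, List.count_cons, ← this, add_comm]
      congr 1
      · simp
      · simp

/-- The height reached by a word after `i` letters. -/
def wordHeight (w : List Bool) (i : ℕ) : ℤ :=
  ((w.take i).count true : ℤ) - (w.take i).count false

theorem htAt_eq_wordHeight {m : ℕ} (P : Fin m → Bool) (i : ℕ) :
    htAt P i = wordHeight (List.ofFn P) i := by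
  rw [htAt, UpCt, DownCt, card_filter_lt_eq_count_take, card_filter_lt_eq_count_take, wordHeight]

theorem wordHeight_append_left (u v : List Bool) {k : ℕ} (hk : k ≤ u.length) :
    wordHeight (u ++ v) k = wordHeight u k := by
  rw [wordHeight, wordHeight, List.take_append_of_le_length hk]

theorem wordHeight_append_right (u v : List Bool) (k : ℕ) :
    wordHeight (u ++ v) (u.length + k) = wordHeight u u.length + wordHeight v k := by
  simp only [wordHeight, List.take_length_add_append, List.count_append, List.take_length]
  push_cast
  ring

theorem wordHeight_succ {w : List Bool} {b : Bool} {j : ℕ} (h : w[j]? = some b) :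
    wordHeight w (j + 1) = wordHeight w j + if b then 1 else -1 := by
  cases b <;> simp [wordHeight, List.take_add_one, h] <;> ring

theorem exists_wordHeight_eq (w : List Bool) (c : ℤ) (hc : 0 ≤ c) (k : ℕ)
    (hk : c ≤ wordHeight w k) : ∃ i ≤ k, wordHeight w i = c := by
  induction k with
  | zero => exact ⟨0, le_rfl, le_antisymm (by simpa [wordHeight] using hc) hk⟩
  | succ k ih =>
    by_cases h : c ≤ wordHeight w k
    · obtain ⟨i, hi, h'⟩ := ih h
      exact ⟨i, by omega, h'⟩
    · refine ⟨k + 1, le_rfl, le_antisymm ?_ hk⟩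
      rcases hb : w[k]? with _ | b
      · have : wordHeight w (k + 1) = wordHeight w k := by
          simp [wordHeight, List.take_add_one, hb]
        omega
      · have := wordHeight_succ hb
        split_ifs at this <;> omega

/-- The last time before `k` at which a word has the same height as after `k` letters. -/
def wordTunnelStart (w : List Bool) (k : ℕ) : ℕ :=
  ((Finset.range k).filter (fun j => wordHeight w j = wordHeight w k)).sup id

theorem tunnelStart_eq_wordTunnelStart {m : ℕ} (P : Fin m → Bool) (k : ℕ) :
    tunnelStart P k = wordTunnelStart (List.ofFn P) k := by
  simp only [tunnelStart, wordTunnelStart, htAt_eq_wordHeight]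

theorem wordTunnelStart_eq {w : List Bool} {m k : ℕ} (hmk : m < k)
    (h : wordHeight w m = wordHeight w k)
    (hne : ∀ i, m < i → i < k → wordHeight w i ≠ wordHeight w k) : wordTunnelStart w k = m := by
  apply le_antisymm
  · refine Finset.sup_le fun i hi => ?_
    rw [Finset.mem_filter, Finset.mem_range] at hi
    by_contra hlt
    exact hne i (by simpa using hlt) hi.1 hi.2
  · exact Finset.le_sup (f := id) (Finset.mem_filter.2 ⟨Finset.mem_range.2 hmk, h⟩)

theorem wordTunnelStart_spec {w : List Bool} {k : ℕ}
    (h : ∃ i < k, wordHeight w i = wordHeight w k) :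
    wordTunnelStart w k < k ∧ wordHeight w (wordTunnelStart w k) = wordHeight w k ∧
      ∀ i, wordTunnelStart w k < i → i < k → wordHeight w i ≠ wordHeight w k := by
  obtain ⟨i, hi, hik⟩ := h
  have hne : ((Finset.range k).filter (fun j => wordHeight w j = wordHeight w k)).Nonempty :=
    ⟨i, Finset.mem_filter.2 ⟨Finset.mem_range.2 hi, hik⟩⟩
  obtain ⟨m, hm, hs⟩ := Finset.exists_mem_eq_sup _ hne id
  rw [Finset.mem_filter, Finset.mem_range] at hm
  rw [wordTunnelStart, hs]
  refine ⟨hm.1, hm.2, fun j hj hjk hjh => ?_⟩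
  have hmem : j ∈ (Finset.range k).filter (fun j => wordHeight w j = wordHeight w k) :=
    Finset.mem_filter.2 ⟨Finset.mem_range.2 hjk, hjh⟩
  have := Finset.le_sup (f := id) hmem
  rw [hs] at this
  exact absurd this (not_le.2 hj)

theorem wordTunnelStart_append_left (u v : List Bool) {k : ℕ} (hk : k ≤ u.length) :
    wordTunnelStart (u ++ v) k = wordTunnelStart u k := by
  rw [wordTunnelStart, wordTunnelStart]
  congr 1
  refine Finset.filter_congr fun i hi => ?_
  rw [Finset.mem_range] at hi
  rw [wordHeight_append_left u v hk, wordHeight_append_left u v (by omega)]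

theorem wordTunnelStart_append_right (u v : List Bool) {k : ℕ}
    (h : ∃ i < k, wordHeight v i = wordHeight v k) :
    wordTunnelStart (u ++ v) (u.length + k) = u.length + wordTunnelStart v k := by
  obtain ⟨h₁, h₂, h₃⟩ := wordTunnelStart_spec h
  refine wordTunnelStart_eq (by omega) ?_ fun i hi hik => ?_
  · rw [wordHeight_append_right, wordHeight_append_right, h₂]
  · obtain ⟨j, rfl⟩ := Nat.exists_eq_add_of_le (show u.length ≤ i by omega)
    rw [wordHeight_append_right, wordHeight_append_right]
    have := h₃ j (by omega) (by omega)
    omega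

/-- The sum of `c j` over the positions `j` at which the factor `x y` occurs in a word. -/
def factorSum (x y : Bool) : List Bool → (ℕ → ℕ) → ℕ
  | [], _ => 0
  | a :: u, c => (if a = x ∧ u.head? = some y then c 0 else 0) + factorSum x y u (fun j => c (j + 1))

theorem sum_filter_eq_factorSum {m : ℕ} (x y : Bool) (P : Fin m → Bool) (c : ℕ → ℕ) :
    ∑ j ∈ univ.filter (fun j : Fin m => P j = x ∧ ∃ h : j.val + 1 < m, P ⟨j.val + 1, h⟩ = y),
      c j.val = factorSum x y (List.ofFn P) c := by
  induction m generalizing c with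
  | zero => simp [factorSum]
  | succ m ih =>
    rw [Finset.sum_filter, Fin.sum_univ_succ, List.ofFn_succ, factorSum,
      ← ih (fun j => P j.succ) (fun j => c (j + 1)), Finset.sum_filter]
    congr 1
    · refine if_congr (and_congr_right' ?_) rfl rfl
      cases m with
      | zero => exact ⟨fun ⟨h, _⟩ => (Nat.lt_irrefl _ h).elim, fun h => by simp at h⟩
      | succ m =>
        rw [List.ofFn_succ, List.head?_cons, Option.some_inj]
        exact ⟨fun ⟨_, h⟩ => h, fun h => ⟨Nat.succ_lt_succ m.succ_pos, h⟩⟩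
    · refine Finset.sum_congr rfl fun j _ => ?_
      simp [Fin.succ]

theorem factorSum_congr {x y : Bool} {w : List Bool} {c d : ℕ → ℕ}
    (h : ∀ j, w[j]? = some x → w[j + 1]? = some y → c j = d j) :
    factorSum x y w c = factorSum x y w d := by
  induction w generalizing c d with
  | nil => rfl
  | cons a u ih =>
    rw [factorSum, factorSum, ih (fun j h₁ h₂ => h (j + 1) (by simpa using h₁) (by simpa using h₂))]
    congr 1
    split_ifs with hc
    · exact h 0 (by simp [hc.1]) (by simpa [List.head?_eq_getElem?] using hc.2)
    · rfl

theorem factorSum_add (x y : Bool) (w : List Bool) (c d : ℕ → ℕ) :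
    factorSum x y w (fun j => c j + d j) = factorSum x y w c + factorSum x y w d := by
  induction w generalizing c d with
  | nil => rfl
  | cons a u ih =>
    rw [factorSum, factorSum, factorSum, ih]
    split_ifs <;> omega

theorem factorSum_append (x y : Bool) (u v : List Bool) (c : ℕ → ℕ) :
    factorSum x y (u ++ v) c = factorSum x y u c + factorSum x y v (fun j => c (u.length + j)) +
      if u.getLast? = some x ∧ v.head? = some y then c (u.length - 1) else 0 := by
  induction u generalizing c with
  | nil => simp [factorSum]
  | cons a u ih =>
    have hc : (fun j => c ((a :: u).length + j)) = fun j => c (u.length + j + 1) := by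
      funext j
      rw [List.length_cons, add_right_comm]
    rw [List.cons_append, factorSum, factorSum, ih, hc]
    cases u with
    | nil => simp [factorSum, add_comm]
    | cons b u => simp [add_assoc]

namespace BinaryTree

/-- The Dyck word encoded by a binary tree. -/
def steps : BinaryTree Unit → List Bool
  | nil => []
  | node _ A B => ([true] ++ steps A) ++ ([false] ++ steps B)

theorem length_steps (T : BinaryTree Unit) : (steps T).length = 2 * numNodes T := by
  induction T with
  | nil => rfl
  | node _ A B hA hB => simp [steps, hA, hB]; ring

theorem head?_steps (T : BinaryTree Unit) :
    (steps T).head? = if T = nil then none else some true := by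
  cases T <;> simp [steps]

theorem getLast?_steps (T : BinaryTree Unit) :
    (steps T).getLast? = if T = nil then none else some false := by
  induction T with
  | nil => simp [steps]
  | node _ A B _ hB =>
    by_cases h : B = nil <;> simp [steps, List.getLast?_append, List.getLast?_cons, hB, h]

theorem steps_eq_map_ofTree (T : BinaryTree Unit) :
    steps T = (DyckWord.ofTree T).toList.map (fun s => decide (s = DyckStep.U)) := by
  induction T with
  | nil => rfl
  | node _ A B hA hB =>
    change _ = List.map _ ((([DyckStep.U] ++ (DyckWord.ofTree A).toList ++ [DyckStep.D]) ++
      (DyckWord.ofTree B).toList))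
    simp [steps, hA, hB]

theorem map_decide_injective :
    Function.Injective (List.map (fun s : DyckStep => decide (s = DyckStep.U))) := by
  apply List.map_injective_iff.2
  intro a b h
  cases a <;> cases b <;> simp_all

theorem count_map_decide (l : List DyckStep) :
    (l.map (fun s => decide (s = DyckStep.U))).count true = l.count DyckStep.U ∧
      (l.map (fun s => decide (s = DyckStep.U))).count false = l.count DyckStep.D := by
  induction l with
  | nil => simp
  | cons a l ih => cases a <;> simp [ih.1, ih.2]

theorem steps_injective : Function.Injective steps := by
  intro S T h
  rw [steps_eq_map_ofTree, steps_eq_map_ofTree] at h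
  exact DyckWord.equivTree.symm.injective (DyckWord.ext (map_decide_injective h))

theorem wordHeight_steps_nonneg (T : BinaryTree Unit) (i : ℕ) : 0 ≤ wordHeight (steps T) i := by
  rw [wordHeight, steps_eq_map_ofTree, ← List.map_take, (count_map_decide _).1,
    (count_map_decide _).2]
  have := (DyckWord.ofTree T).count_D_le_count_U i
  omega

theorem wordHeight_steps_length (T : BinaryTree Unit) :
    wordHeight (steps T) (steps T).length = 0 := by
  rw [wordHeight, List.take_length, steps_eq_map_ofTree, (count_map_decide _).1,
    (count_map_decide _).2, (DyckWord.ofTree T).count_U_eq_count_D, sub_self]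

theorem isDyck_iff_exists_steps {m : ℕ} (P : Fin m → Bool) :
    IsDyck P ↔ ∃ T, List.ofFn P = steps T := by
  have ht : ∀ i, (UpCt P i : ℤ) - DownCt P i = wordHeight (List.ofFn P) i :=
    htAt_eq_wordHeight P
  constructor
  · rintro ⟨h₁, h₂⟩
    have hl : ∀ l : List Bool, (l.map (fun b => bif b then DyckStep.U else DyckStep.D)).map
        (fun s => decide (s = DyckStep.U)) = l := by
      intro l
      induction l with
      | nil => rfl
      | cons a l ih => cases a <;> simpa using ih
    set l := (List.ofFn P).map (fun b => bif b then DyckStep.U else DyckStep.D) with hldef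
    have hU : ∀ i, (l.take i).count DyckStep.U = UpCt P i := by
      intro i
      rw [← (count_map_decide _).1, List.map_take, hl, UpCt, card_filter_lt_eq_count_take]
    have hD : ∀ i, (l.take i).count DyckStep.D = DownCt P i := by
      intro i
      rw [← (count_map_decide _).2, List.map_take, hl, DownCt, card_filter_lt_eq_count_take]
    have hlen : l.length = m := by simp [hldef]
    have htake : ∀ i, m ≤ i → l.take i = l.take m := fun i hi => by
      rw [List.take_of_length_le (by omega), List.take_of_length_le (by omega)]
    have hm : (l.take m).count DyckStep.U = (l.take m).count DyckStep.D := by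
      rw [hU, hD, h₂]
    let w : DyckWord := ⟨l, by rwa [List.take_of_length_le hlen.le] at hm, fun i => by
      rcases le_total i m with hi | hi
      · rw [hU, hD]; exact h₁ i hi
      · rw [htake i hi, hm]⟩
    refine ⟨w.toTree, ?_⟩
    rw [steps_eq_map_ofTree, DyckWord.ofTree_toTree]
    exact (hl _).symm
  · rintro ⟨T, hT⟩
    have hlen : (steps T).length = m := by rw [← hT, List.length_ofFn]
    rw [hT] at ht
    have h₀ := wordHeight_steps_length T
    rw [hlen, ← ht] at h₀
    refine ⟨fun i _ => ?_, by omega⟩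
    have := wordHeight_steps_nonneg T i
    rw [← ht] at this
    omega

theorem factorSum_steps_node_peak (A B : BinaryTree Unit) (c : ℕ → ℕ) :
    factorSum true false (steps (node () A B)) c =
      (if A = nil then c 0 else 0) + factorSum true false (steps A) (fun j => c (1 + j)) +
        factorSum true false (steps B) (fun j => c ((steps A).length + 2 + j)) := by
  rw [steps, factorSum_append, factorSum_append, factorSum_append]
  by_cases hA : A = nil
  · subst hA
    simp [factorSum, steps, head?_steps, ← add_assoc]
    ring
  · have h : ∀ j, (steps A).length + 1 + (1 + j) = (steps A).length + 2 + j := fun j => by omega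
    simp [factorSum, head?_steps, getLast?_steps, List.getLast?_cons, hA, h]

theorem factorSum_steps_node_valley (A B : BinaryTree Unit) (c : ℕ → ℕ) :
    factorSum false true (steps (node () A B)) c =
      factorSum false true (steps A) (fun j => c (1 + j)) +
        factorSum false true (steps B) (fun j => c ((steps A).length + 2 + j)) +
        if B = nil then 0 else c ((steps A).length + 1) := by
  rw [steps, factorSum_append, factorSum_append, factorSum_append]
  have h : ∀ j, (steps A).length + 1 + (1 + j) = (steps A).length + 2 + j := fun j => by omega
  simp [factorSum, head?_steps, h, add_assoc]

theorem factorSum_peak_one (T : BinaryTree Unit) :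
    factorSum true false (steps T) (fun _ => 1) = leftEnds T := by
  induction T with
  | nil => rfl
  | node _ A B hA hB =>
    rw [factorSum_steps_node_peak, hA, hB, leftEnds]
    by_cases h : A = nil
    · subst h; simp [leftEnds]
    · simp [h]

theorem factorSum_valley_one (T : BinaryTree Unit) :
    factorSum false true (steps T) (fun _ => 1) = rightEdges T := by
  induction T with
  | nil => rfl
  | node _ A B hA hB =>
    rw [factorSum_steps_node_valley, hA, hB, rightEdges]

theorem wordHeight_steps_node_left (A B : BinaryTree Unit) {j : ℕ} (hj : j ≤ (steps A).length) :
    wordHeight (steps (node () A B)) (1 + j) = 1 + wordHeight (steps A) j := by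
  rw [steps, wordHeight_append_left _ _ (by simp; omega)]
  exact wordHeight_append_right [true] _ _

theorem wordHeight_steps_node_right (A B : BinaryTree Unit) (j : ℕ) :
    wordHeight (steps (node () A B)) ((steps A).length + 2 + j) = wordHeight (steps B) j := by
  have h := wordHeight_append_right ([true] ++ steps A ++ [false]) (steps B) j
  have h' : wordHeight ([true] ++ steps A ++ [false]) ([true] ++ steps A ++ [false]).length = 0 := by
    have := wordHeight_steps_length (node () A nil)
    simpa [steps] using this
  rw [h', zero_add] at h
  rw [← h, steps]
  simp [add_comm, add_left_comm]

theorem factorSum_peak_height (T : BinaryTree Unit) :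
    factorSum true false (steps T) (fun j => (wordHeight (steps T) (j + 1) - 1).toNat) =
      leftEndSum T := by
  induction T with
  | nil => rfl
  | node _ A B hA hB =>
    have h₀ : wordHeight (steps (node () A B)) 1 = 1 := by
      simpa [wordHeight] using wordHeight_steps_node_left A B (Nat.zero_le _)
    rw [factorSum_steps_node_peak, leftEndSum, ← hA, ← hB, ← factorSum_peak_one A,
      ← factorSum_add]
    simp only [zero_add, h₀, sub_self, Int.toNat_zero, ite_self]
    congr 1
    · refine factorSum_congr fun j h₁ h₂ => ?_
      have hj : j + 1 < (steps A).length := (List.getElem?_eq_some_iff.1 h₂).1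
      have h₃ := wordHeight_succ h₁
      have h₄ := wordHeight_steps_nonneg A j
      rw [add_assoc, wordHeight_steps_node_left A B hj.le]
      simp only [if_true] at h₃
      omega
    · refine factorSum_congr fun j _ _ => ?_
      rw [add_assoc, wordHeight_steps_node_right]

theorem exists_wordHeight_steps_eq {T : BinaryTree Unit} {j : ℕ}
    (h : (steps T)[j]? = some false) :
    ∃ i < j + 1, wordHeight (steps T) i = wordHeight (steps T) (j + 1) := by
  have h' := wordHeight_succ h
  simp only [Bool.false_eq_true, if_false] at h'
  obtain ⟨i, hi, hh⟩ := exists_wordHeight_eq (steps T) _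
    (wordHeight_steps_nonneg T (j + 1)) j (by omega)
  exact ⟨i, by omega, hh⟩

theorem wordTunnelStart_steps_node_left (A B : BinaryTree Unit) {j : ℕ}
    (h : (steps A)[j]? = some false) :
    wordTunnelStart (steps (node () A B)) (1 + (j + 1)) =
      1 + wordTunnelStart (steps A) (j + 1) := by
  have hj : j < (steps A).length := (List.getElem?_eq_some_iff.1 h).1
  rw [steps, wordTunnelStart_append_left _ _ (by simp; omega)]
  exact wordTunnelStart_append_right [true] _ (exists_wordHeight_steps_eq h)

theorem wordTunnelStart_steps_node_right (A B : BinaryTree Unit) {j : ℕ}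
    (h : (steps B)[j]? = some false) :
    wordTunnelStart (steps (node () A B)) ((steps A).length + 2 + (j + 1)) =
      (steps A).length + 2 + wordTunnelStart (steps B) (j + 1) := by
  have := wordTunnelStart_append_right ([true] ++ steps A ++ [false]) (steps B)
    (exists_wordHeight_steps_eq h)
  simpa [steps, add_comm, add_left_comm] using this

theorem wordTunnelStart_steps_node_middle (A B : BinaryTree Unit) :
    wordTunnelStart (steps (node () A B)) ((steps A).length + 2) = 0 := by
  have h : wordHeight (steps (node () A B)) ((steps A).length + 2) = 0 := by
    simpa [wordHeight] using wordHeight_steps_node_right A B 0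
  refine wordTunnelStart_eq (by omega) ?_ fun i hi hi' => ?_
  · rw [h]; simp [wordHeight]
  · obtain ⟨j, rfl⟩ := Nat.exists_eq_add_of_le (show 1 ≤ i by omega)
    rw [h, wordHeight_steps_node_left A B (by omega)]
    have := wordHeight_steps_nonneg A j
    omega

theorem factorSum_valley_tunnel (T : BinaryTree Unit) :
    factorSum false true (steps T) (fun j => (j + 1 - wordTunnelStart (steps T) (j + 1)) / 2) =
      leftSizeSum T := by
  induction T with
  | nil => rfl
  | node _ A B hA hB =>
    rw [factorSum_steps_node_valley, leftSizeSum, ← hA, ← hB]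
    congr 1
    · congr 1
      · refine factorSum_congr fun j h₁ _ => ?_
        rw [add_assoc, wordTunnelStart_steps_node_left A B h₁, Nat.add_sub_add_left]
      · refine factorSum_congr fun j h₁ _ => ?_
        rw [add_assoc, wordTunnelStart_steps_node_right A B h₁, Nat.add_sub_add_left]
    · rw [wordTunnelStart_steps_node_middle, length_steps]
      split_ifs
      · rfl
      · omega

/-- Sums over Dyck paths are sums over binary trees. -/
theorem sum_DyckSet {M : Type*} [AddCommMonoid M] (n : ℕ) (f : (Fin (2 * n) → Bool) → M)
    (g : BinaryTree Unit → M) (h : ∀ P T, List.ofFn P = steps T → f P = g T) :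
    ∑ P ∈ DyckSet n, f P = ∑ T ∈ treesOfNumNodesEq n, g T := by
  have hof : ∀ T ∈ treesOfNumNodesEq n,
      List.ofFn (fun j : Fin (2 * n) => (steps T).getD j.val false) = steps T := by
    intro T hT
    have hlen := length_steps T
    rw [mem_treesOfNumNodesEq.1 hT] at hlen
    refine List.ext_getElem (by simp [hlen]) fun i h₁ h₂ => ?_
    simp [List.getD_eq_getElem?_getD, List.getElem?_eq_getElem h₂]
  symm
  refine Finset.sum_bij (fun T _ => fun j : Fin (2 * n) => (steps T).getD j.val false)
    (fun T hT => ?_) (fun S hS T hT hST => ?_) (fun P hP => ?_) (fun T hT => ?_)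
  · exact Finset.mem_filter.2 ⟨Finset.mem_univ _, (isDyck_iff_exists_steps _).2 ⟨T, hof T hT⟩⟩
  · apply steps_injective
    rw [← hof S hS, ← hof T hT, hST]
  · obtain ⟨T, hT⟩ := (isDyck_iff_exists_steps P).1 (Finset.mem_filter.1 hP).2
    have hlen := congrArg List.length hT
    rw [List.length_ofFn, length_steps] at hlen
    have hmem : T ∈ treesOfNumNodesEq n := mem_treesOfNumNodesEq.2 (by omega)
    exact ⟨T, hmem, List.ofFn_injective ((hof T hmem).trans hT.symm)⟩
  · exact (h _ T (hof T hT)).symm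

variable {m : ℕ} {P : Fin m → Bool} {T : BinaryTree Unit}

theorem npea_eq_leftEnds (h : List.ofFn P = steps T) : npea P = leftEnds T := by
  rw [npea, Finset.card_eq_sum_ones, Peaks, sum_filter_eq_factorSum true false P (fun _ => 1), h,
    factorSum_peak_one]

theorem spea_eq_leftEndSum (h : List.ofFn P = steps T) : spea P = leftEndSum T := by
  rw [← factorSum_peak_height, ← h, ← sum_filter_eq_factorSum, spea, Peaks]
  refine Finset.sum_congr rfl fun j _ => ?_
  rw [← htAt_eq_wordHeight, htAt]
  omega

theorem desPath_eq_rightEdges (h : List.ofFn P = steps T) : desPath P = rightEdges T := by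
  rw [desPath, Finset.card_eq_sum_ones, Valleys,
    sum_filter_eq_factorSum false true P (fun _ => 1), h, factorSum_valley_one]

theorem stun_eq_leftSizeSum (h : List.ofFn P = steps T) : stun P = leftSizeSum T := by
  rw [← factorSum_valley_tunnel, ← h, ← sum_filter_eq_factorSum, stun, Valleys]
  refine Finset.sum_congr rfl fun j _ => ?_
  rw [tunnelStart_eq_wordTunnelStart]

end BinaryTree

/-- `(spea, npea)` and `(stun, n - des)` are equidistributed over `D_n`. -/
theorem stmt6 (n : ℕ) (hn : 1 ≤ n) :
    (∑ P ∈ DyckSet n, (X 0 : MvPolynomial (Fin 2) ℤ) ^ spea P * X 1 ^ npea P) =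
      ∑ P ∈ DyckSet n, (X 0 : MvPolynomial (Fin 2) ℤ) ^ stun P * X 1 ^ (n - desPath P) := by
  rw [BinaryTree.sum_DyckSet n _
      (fun T => X 0 ^ BinaryTree.leftEndSum T * X 1 ^ BinaryTree.leftEnds T),
    BinaryTree.sum_leftEnds_eq_sum_rightEnds, eq_comm]
  · refine BinaryTree.sum_DyckSet n _ _ fun P T h => ?_
    have hlen := congrArg List.length h
    rw [List.length_ofFn, BinaryTree.length_steps] at hlen
    have := BinaryTree.rightEdges_add_rightEnds T
    rw [BinaryTree.stun_eq_leftSizeSum h, BinaryTree.desPath_eq_rightEdges h]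
    congr 2
    omega
  · intro P T h
    rw [BinaryTree.spea_eq_leftEndSum h, BinaryTree.npea_eq_leftEnds h]
end

section
/- For every integer n ≥ 2, Σ_{(U,V)∈𝒫_n} q^{maj V} t^{des V} = M_{n-1}(q,t) + (q^{n-1}t − 1)·M_{n-2}(q,t), as an identity in ℤ[q,t], where the sum is over all parallelogram polyominoes of size n and the statistics maj and des are applied to the lower path V. -/
open Finset MvPolynomial

/-- The number of letters equal to `b` among the first `i` letters of the word `w`. -/
def letterCt {m : ℕ} (b : Bool) (w : Fin m → Bool) (i : ℕ) : ℕ :=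
  #{j : Fin m | j.val < i ∧ w j = b}

lemma letterCt_mono {m : ℕ} (b : Bool) (w : Fin m → Bool) : Monotone (letterCt b w) :=
  fun _ _ h => card_le_card fun j hj => by
    simp only [mem_filter, mem_univ, true_and] at hj ⊢
    exact ⟨hj.1.trans_le h, hj.2⟩

lemma letterCt_succ {m : ℕ} (b : Bool) (w : Fin m → Bool) (i : Fin m) :
    letterCt b w (i + 1) = letterCt b w i + if w i = b then 1 else 0 := by
  unfold letterCt
  split_ifs with h
  · rw [← card_insert_of_notMem (a := i) (by simp)]
    congr 1
    ext j
    simp only [mem_filter, mem_univ, true_and, mem_insert, Fin.ext_iff]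
    constructor
    · rintro ⟨h1, h2⟩
      by_cases hj : j.val = i.val
      · exact Or.inl hj
      · exact Or.inr ⟨by omega, h2⟩
    · rintro (h1 | ⟨h1, h2⟩)
      · exact ⟨by omega, by rwa [Fin.ext h1]⟩
      · exact ⟨by omega, h2⟩
  · rw [add_zero]
    congr 1
    ext j
    simp only [mem_filter, mem_univ, true_and]
    constructor
    · rintro ⟨h1, h2⟩
      refine ⟨?_, h2⟩
      by_contra hj
      exact h (by rwa [show i = j from Fin.ext (by omega)])
    · rintro ⟨h1, h2⟩
      exact ⟨by omega, h2⟩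

lemma letterCt_lt {m : ℕ} {b : Bool} {w : Fin m → Bool} {i : Fin m} (h : w i = b) {k : ℕ}
    (hk : i.val < k) : letterCt b w i < letterCt b w k := by
  have h1 := letterCt_succ b w i
  rw [if_pos h] at h1
  have h2 := letterCt_mono b w (Nat.succ_le_of_lt hk)
  simp only [Nat.succ_eq_add_one] at h2
  omega

lemma eq_of_letterCt_eq {m : ℕ} {b : Bool} {w : Fin m → Bool} {i j : Fin m} (hi : w i = b)
    (hj : w j = b) (h : letterCt b w i = letterCt b w j) : i = j := by
  rcases lt_trichotomy i j with hij | hij | hij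
  · exact absurd h (letterCt_lt hi hij).ne
  · exact hij
  · exact absurd h (letterCt_lt hj hij).ne'

lemma letterCt_true_add_false {m : ℕ} (w : Fin m → Bool) {i : ℕ} (hi : i ≤ m) :
    letterCt true w i + letterCt false w i = i := by
  induction i with
  | zero => simp [letterCt]
  | succ i ih =>
    have h1 := letterCt_succ true w ⟨i, hi⟩
    have h2 := letterCt_succ false w ⟨i, hi⟩
    have h3 := ih (by omega)
    simp only at h1 h2
    rw [h1, h2]
    cases w ⟨i, hi⟩ <;> simp <;> omega

lemma letterCt_apply_of_strictMonoOn {m : ℕ} {σ : Equiv.Perm (Fin m)} {p u : Fin m → Bool}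
    {b : Bool} (hpu : ∀ j, u (σ j) = p j) (hσ : StrictMonoOn σ {j | p j = b}) {i : Fin m}
    (hi : p i = b) : letterCt b u (σ i) = letterCt b p i := by
  symm
  refine card_nbij σ ?_ σ.injective.injOn ?_
  · intro j hj
    simp only [coe_filter, mem_univ, true_and, Set.mem_ofPred_eq] at hj ⊢
    exact ⟨hσ hj.2 hi hj.1, by rw [hpu, hj.2]⟩
  · intro k hk
    simp only [coe_filter, mem_univ, true_and, Set.mem_ofPred_eq] at hk
    have hk2 : p (σ.symm k) = b := by rw [← hpu, σ.apply_symm_apply, hk.2]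
    refine ⟨σ.symm k, ?_, σ.apply_symm_apply k⟩
    simp only [coe_filter, mem_univ, true_and, Set.mem_ofPred_eq]
    refine ⟨?_, hk2⟩
    rw [← Fin.lt_def, ← hσ.lt_iff_lt hk2 hi, σ.apply_symm_apply]
    exact hk.1

/-- The word recording, with letter `true`, the positions `i` with `σ i < i`. -/
def posWord {m : ℕ} (σ : Equiv.Perm (Fin m)) (i : Fin m) : Bool := decide (σ i < i)

/-- The word recording, with letter `true`, the values `σ i` with `σ i < i`. -/
def valWord {m : ℕ} (σ : Equiv.Perm (Fin m)) (k : Fin m) : Bool := decide (k < σ.symm k)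

lemma valWord_apply {m : ℕ} (σ : Equiv.Perm (Fin m)) (j : Fin m) :
    valWord σ (σ j) = posWord σ j := by
  simp [valWord, posWord]

lemma exists_gt_apply_lt {m : ℕ} {σ : Equiv.Perm (Fin m)} {i j : Fin m} (hj : j ≤ σ j)
    (h : σ j < σ i) (hij : i < j) : ∃ k, j < k ∧ σ k < σ j := by
  by_contra! hc
  have h1 : #(Ioi j) ≤ #((Ioi (σ j)).erase (σ i)) := by
    refine card_le_card_of_injOn σ ?_ σ.injective.injOn
    intro k hk
    simp only [coe_Ioi, Set.mem_Ioi, coe_erase, Set.mem_sdiff, Set.mem_singleton_iff] at hk ⊢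
    exact ⟨(hc k hk).lt_of_ne fun e => hk.ne (σ.injective e),
      fun e => (hij.trans hk).ne' (σ.injective e)⟩
  rw [card_erase_of_mem (by simpa using h), Fin.card_Ioi, Fin.card_Ioi] at h1
  have := (σ i).isLt
  simp only [Fin.lt_def, Fin.le_def] at *
  omega

lemma exists_lt_apply_gt {m : ℕ} {σ : Equiv.Perm (Fin m)} {i : Fin m} (hi : σ i < i) :
    ∃ k, k < i ∧ σ i < σ k := by
  by_contra! hc
  have h1 : #(Iic i) ≤ #(Iic (σ i)) := by
    refine card_le_card_of_injOn σ ?_ σ.injective.injOn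
    intro k hk
    simp only [coe_Iic, Set.mem_Iic] at hk ⊢
    rcases hk.eq_or_lt with rfl | hk
    · exact le_rfl
    · exact hc k hk
  rw [Fin.card_Iic, Fin.card_Iic] at h1
  simp only [Fin.lt_def] at *
  omega

lemma Avoids321.strictMonoOn {m : ℕ} {σ : Equiv.Perm (Fin m)} (h : Avoids321 σ) (b : Bool) :
    StrictMonoOn σ {j | posWord σ j = b} := by
  intro i hi j hj hij
  by_contra! hc
  have hc := hc.lt_of_ne fun e => hij.ne' (σ.injective e)
  cases b
  · simp only [posWord, Set.mem_ofPred_eq, decide_eq_false_iff_not, not_lt] at hi hj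
    obtain ⟨k, hk, hk2⟩ := exists_gt_apply_lt hj hc hij
    exact h ⟨i, j, k, hij, hk, hk2, hc⟩
  · simp only [posWord, Set.mem_ofPred_eq, decide_eq_true_eq] at hi hj
    obtain ⟨k, hk, hk2⟩ := exists_lt_apply_gt hi
    exact h ⟨k, i, j, hk, hij, hc, hk2⟩

lemma avoids321_of_strictMonoOn {m : ℕ} {σ : Equiv.Perm (Fin m)} {p : Fin m → Bool}
    (h : ∀ b, StrictMonoOn σ {j | p j = b}) : Avoids321 σ := by
  rintro ⟨i, j, k, hij, hjk, h1, h2⟩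
  have key : ∀ a c, a < c → σ c < σ a → p a ≠ p c := fun a c hac hca e =>
    (h (p c) (show p a = p c from e) (show p c = p c from rfl) hac).not_gt hca
  have h3 := key i j hij h2
  have h4 := key j k hjk h1
  have h5 := key i k (hij.trans hjk) (h1.trans h2)
  revert h3 h4 h5
  cases p i <;> cases p j <;> cases p k <;> simp

lemma eq_of_words_eq {m : ℕ} {σ τ : Equiv.Perm (Fin m)} (hσ : Avoids321 σ) (hτ : Avoids321 τ)
    (hp : posWord σ = posWord τ) (hv : valWord σ = valWord τ) : σ = τ := by
  ext1 i
  have h1 := letterCt_apply_of_strictMonoOn (valWord_apply σ) (hσ.strictMonoOn (posWord σ i)) rfl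
  have h2 := letterCt_apply_of_strictMonoOn (valWord_apply τ) (hτ.strictMonoOn (posWord τ i)) rfl
  rw [← hp, ← hv, ← h1] at h2
  exact (eq_of_letterCt_eq (by rw [hv, valWord_apply, hp]) (valWord_apply σ i) h2).symm

lemma exists_perm_of_letterCt_eq {m : ℕ} {p u : Fin m → Bool}
    (h : letterCt true p m = letterCt true u m) :
    ∃ σ : Equiv.Perm (Fin m), (∀ j, u (σ j) = p j) ∧ ∀ b, StrictMonoOn σ {j | p j = b} := by
  have hcard : ∀ (w : Fin m → Bool) b, Fintype.card {j // w j = b} = letterCt b w m := fun w b => by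
    simp [letterCt, Fintype.card_subtype]
  have h' : letterCt false p m = letterCt false u m := by
    have := letterCt_true_add_false p le_rfl
    have := letterCt_true_add_false u le_rfl
    omega
  have hiso : ∀ b, Nonempty ({j // p j = b} ≃o {j // u j = b}) := fun b => by
    have hb : letterCt b p m = letterCt b u m := by cases b <;> assumption
    exact ⟨(Fintype.orderIsoFinOfCardEq _ ((hcard p b).trans hb)).symm.trans
      (Fintype.orderIsoFinOfCardEq _ (hcard u b))⟩
  have hf : ∃ f : ∀ b, {j // p j = b} ≃o {j // u j = b}, True := ⟨fun b => (hiso b).some, trivial⟩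
  obtain ⟨f, -⟩ := hf
  let e : Fin m → Fin m := fun j => f (p j) ⟨j, rfl⟩
  have he : ∀ b j (hj : p j = b), e j = f b ⟨j, hj⟩ := by rintro _ j rfl; rfl
  have hu : ∀ j, u (e j) = p j := fun j => (f (p j) ⟨j, rfl⟩).2
  have hinj : Function.Injective e := fun i j hij => by
    have hp : p i = p j := by rw [← hu, ← hu, hij]
    rw [he _ i hp, he _ j rfl, Subtype.val_inj, (f _).injective.eq_iff] at hij
    exact congrArg Subtype.val hij
  refine ⟨Equiv.ofBijective e (Finite.injective_iff_bijective.1 hinj), hu, ?_⟩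
  intro b i hi j hj hij
  rw [Equiv.ofBijective_apply, Equiv.ofBijective_apply, he b i hi, he b j hj]
  exact (f b).strictMono (Subtype.mk_lt_mk.2 hij)

/-- A pair of words that encodes a 321-avoiding permutation by its non-excedance positions and
values. -/
def IsEncoding {m : ℕ} (u p : Fin m → Bool) : Prop :=
  letterCt true p m = letterCt true u m ∧ ∀ i < m, letterCt true p (i + 1) ≤ letterCt true u i

lemma isEncoding_words {m : ℕ} (σ : Equiv.Perm (Fin m)) : IsEncoding (valWord σ) (posWord σ) := by
  constructor
  · refine card_nbij σ ?_ σ.injective.injOn ?_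
    · intro j hj
      simpa [valWord_apply] using hj
    · intro k hk
      refine ⟨σ.symm k, ?_, σ.apply_symm_apply k⟩
      simpa [← valWord_apply] using hk
  · intro i _
    refine card_le_card_of_injOn σ ?_ σ.injective.injOn
    intro j hj
    simp only [posWord, coe_filter, mem_univ, true_and, decide_eq_true_eq, Set.mem_ofPred_eq,
      valWord_apply] at hj ⊢
    exact ⟨lt_of_lt_of_le hj.2 (Nat.lt_succ_iff.1 hj.1), hj.2⟩

lemma IsEncoding.exists_perm {m : ℕ} {u p : Fin m → Bool} (h : IsEncoding u p) :
    ∃ σ : Equiv.Perm (Fin m), Avoids321 σ ∧ valWord σ = u ∧ posWord σ = p := by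
  obtain ⟨σ, hu, hmono⟩ := exists_perm_of_letterCt_eq h.1
  have hp : ∀ j, σ j < j ↔ p j = true := by
    intro j
    have hct := letterCt_apply_of_strictMonoOn hu (hmono (p j)) rfl
    have hj := h.2 j j.isLt
    constructor
    · intro hlt
      by_contra hpj
      rw [Bool.not_eq_true] at hpj
      rw [hpj] at hct
      have h1 := letterCt_lt (hu j |>.trans hpj) hlt
      have h2 := letterCt_true_add_false u j.isLt.le
      have h3 := letterCt_true_add_false p j.isLt.le
      have h4 := letterCt_mono true p j.val.le_succ
      simp only [Nat.succ_eq_add_one] at h4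
      obtain ⟨j', hj'⟩ : ∃ j', j.val = j' + 1 := ⟨j.val - 1, by
        have := Fin.lt_def.1 hlt; omega⟩
      have h5 := h.2 j' (by omega)
      have h6 := letterCt_true_add_false u (show j' ≤ m by omega)
      have h7 := letterCt_mono true u (show j' ≤ j.val by omega)
      have h8 := letterCt_mono false u (show j' ≤ j.val by omega)
      rw [← hj'] at h5
      have h9 := letterCt_mono false u (show (σ j).val ≤ j' by have := Fin.lt_def.1 hlt; omega)
      omega
    · intro hpj
      rw [hpj] at hct
      rw [letterCt_succ, if_pos hpj] at hj
      by_contra! hle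
      have := letterCt_mono true u (Fin.le_def.1 hle)
      omega
  refine ⟨σ, avoids321_of_strictMonoOn hmono, ?_, ?_⟩
  · ext k
    have := hp (σ.symm k)
    rw [← hu, σ.apply_symm_apply] at this
    simp [valWord, this]
  · ext j
    simp [posWord, hp]

lemma letterCt_snoc {m : ℕ} (b c : Bool) (w : Fin m → Bool) {i : ℕ} (hi : i ≤ m) :
    letterCt b (Fin.snoc w c : Fin (m + 1) → Bool) i = letterCt b w i := by
  induction i with
  | zero => simp [letterCt]
  | succ i ih =>
    have h1 := letterCt_succ b w ⟨i, hi⟩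
    have h2 := letterCt_succ b (Fin.snoc w c : Fin (m + 1) → Bool) (Fin.castSucc ⟨i, hi⟩)
    rw [Fin.snoc_castSucc] at h2
    simp only [Fin.val_castSucc] at h1 h2
    rw [h1, h2, ih (by omega)]

lemma letterCt_cons {m : ℕ} (b c : Bool) (w : Fin m → Bool) {i : ℕ} (hi : i ≤ m) :
    letterCt b (Fin.cons c w : Fin (m + 1) → Bool) (i + 1) =
      (if c = b then 1 else 0) + letterCt b w i := by
  induction i with
  | zero =>
    have := letterCt_succ b (Fin.cons c w : Fin (m + 1) → Bool) 0
    simpa [letterCt] using this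
  | succ i ih =>
    have h1 := letterCt_succ b w ⟨i, hi⟩
    have h2 := letterCt_succ b (Fin.cons c w : Fin (m + 1) → Bool) (Fin.succ ⟨i, hi⟩)
    rw [Fin.cons_succ] at h2
    simp only [Fin.val_succ] at h1 h2
    rw [h1, h2, ih (by omega), add_assoc]

lemma letterCt_snoc_self {m : ℕ} (b c : Bool) (w : Fin m → Bool) :
    letterCt b (Fin.snoc w c : Fin (m + 1) → Bool) (m + 1) =
      letterCt b w m + if c = b then 1 else 0 := by
  have := letterCt_succ b (Fin.snoc w c : Fin (m + 1) → Bool) (Fin.last m)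
  rwa [Fin.snoc_last, Fin.val_last, letterCt_snoc b c w le_rfl] at this

lemma isParaPoly_cons_snoc {k : ℕ} (u p : Fin (k + 1) → Bool) :
    IsParaPoly (Fin.cons true u : Fin (k + 2) → Bool) (Fin.snoc p true : Fin (k + 2) → Bool) ↔
      IsEncoding u p := by
  change letterCt _ _ _ = letterCt _ _ _ ∧
    (∀ i, i < k + 2 → 1 ≤ i → letterCt _ _ _ < letterCt _ _ _) ∧
    letterCt _ _ _ = 0 ∧ letterCt _ _ _ = letterCt _ _ (k + 1) ↔ _
  rw [letterCt_cons _ _ _ le_rfl, letterCt_snoc_self, letterCt_snoc _ _ _ (by omega),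
    letterCt_cons _ _ _ (by omega), if_pos rfl]
  have hmono := letterCt_mono true u (show k ≤ k + 1 by omega)
  have hsucc : ∀ i < k + 1, letterCt true (Fin.snoc p true : Fin (k + 2) → Bool) (i + 1) <
      letterCt true (Fin.cons true u : Fin (k + 2) → Bool) (i + 1) ↔
      letterCt true p (i + 1) ≤ letterCt true u i := fun i hi => by
    rw [letterCt_snoc _ _ _ (show i + 1 ≤ k + 1 from hi), letterCt_cons _ _ _ hi.le, if_pos rfl]
    omega
  constructor
  · rintro ⟨h1, h2, -, -⟩
    exact ⟨by omega, fun i hi => (hsucc i hi).1 (h2 (i + 1) (by omega) (by omega))⟩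
  · rintro ⟨h1, h2⟩
    refine ⟨by omega, fun i hi hi' => ?_, ?_, ?_⟩
    · obtain ⟨i, rfl⟩ := Nat.exists_eq_add_of_le' hi'
      exact (hsucc i (by omega)).2 (h2 i (by omega))
    · have := h2 0 (by omega)
      simpa [letterCt] using this
    · have := h2 k (by omega)
      omega

lemma IsParaPoly.exists_eq_cons_snoc {k : ℕ} {U V : Fin (k + 2) → Bool} (h : IsParaPoly U V) :
    ∃ u p : Fin (k + 1) → Bool, U = Fin.cons true u ∧ V = Fin.snoc p true := by
  obtain ⟨h1, h2, h3, h4⟩ := h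
  have hU : U 0 = true := by
    have ha := letterCt_succ true U 0
    have hb := h2 1 (by omega) le_rfl
    by_contra hc
    rw [if_neg hc] at ha
    have : letterCt true U 1 = 0 := by simpa [letterCt] using ha
    exact absurd (hb.trans_eq this) (Nat.not_lt_zero _)
  have hV : V (Fin.last _) = true := by
    have ha := letterCt_succ true V (Fin.last _)
    have hb := h2 (k + 1) (by omega) (by omega)
    by_contra hc
    rw [if_neg hc] at ha
    have hd : UpCt V (k + 2) = UpCt V (k + 1) := ha
    have he : UpCt U (k + 2) = UpCt U (k + 1) := h4
    omega
  refine ⟨Fin.tail U, Fin.init V, ?_, ?_⟩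
  · rw [← hU, Fin.cons_self_tail]
  · rw [← hV, Fin.snoc_init_self]

/-- The monomial `q^{Σ i} t^{#s}` of a set `s` of (0-based) descent positions. -/
noncomputable def descentMonomial {n : ℕ} (s : Finset (Fin n)) : MvPolynomial (Fin 2) ℤ :=
  X 0 ^ (∑ i ∈ s, (i.val + 1)) * X 1 ^ #s

lemma descentMonomial_map_castSucc {n : ℕ} (s : Finset (Fin n)) :
    descentMonomial (s.map Fin.castSuccEmb) = descentMonomial s := by
  simp [descentMonomial]

lemma descentMonomial_insert {n : ℕ} {s : Finset (Fin n)} {i : Fin n} (hi : i ∉ s) :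
    descentMonomial (insert i s) = X 0 ^ (i.val + 1) * X 1 * descentMonomial s := by
  rw [descentMonomial, descentMonomial, sum_insert hi, card_insert_of_notMem hi]
  ring

lemma Avoids321.desPerm_eq {m : ℕ} {σ : Equiv.Perm (Fin m)} (h : Avoids321 σ) :
    DesPerm σ = Valleys (posWord σ) := by
  ext i
  simp only [DesPerm, Valleys, mem_filter, mem_univ, true_and]
  constructor
  · rintro ⟨hi, hlt⟩
    have hii : i < ⟨i.val + 1, hi⟩ := Fin.lt_def.2 (Nat.lt_succ_self _)
    have hne : posWord σ i ≠ posWord σ ⟨i.val + 1, hi⟩ := fun e =>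
      ((h.strictMonoOn _) e rfl hii).not_gt hlt
    have : posWord σ i = false := by
      by_contra hc
      rw [Bool.not_eq_false] at hc
      rw [hc, ne_comm, ne_eq, Bool.not_eq_true] at hne
      simp only [posWord, decide_eq_true_eq, decide_eq_false_iff_not, Fin.lt_def] at hc hne hlt
      omega
    refine ⟨this, hi, ?_⟩
    rw [this] at hne
    simpa using hne.symm
  · rintro ⟨h1, hi, h2⟩
    refine ⟨hi, ?_⟩
    have hne : (σ i).val ≠ (σ ⟨i.val + 1, hi⟩).val := fun e => by
      have := congrArg Fin.val (σ.injective (Fin.ext e))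
      simp at this
    simp only [posWord, decide_eq_true_eq, decide_eq_false_iff_not, Fin.lt_def] at h1 h2 ⊢
    omega

lemma valleys_snoc_true {k : ℕ} (p : Fin (k + 1) → Bool) :
    Valleys (Fin.snoc p true : Fin (k + 2) → Bool) =
      if p (Fin.last k) = false then
        insert (Fin.castSucc (Fin.last k)) ((Valleys p).map Fin.castSuccEmb)
      else (Valleys p).map Fin.castSuccEmb := by
  have hmem : ∀ j : Fin (k + 1), Fin.castSucc j ∈ Valleys (Fin.snoc p true : Fin (k + 2) → Bool) ↔
      j ∈ Valleys p ∨ (j = Fin.last k ∧ p (Fin.last k) = false) := by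
    intro j
    simp only [Valleys, mem_filter, mem_univ, true_and, Fin.snoc_castSucc]
    induction j using Fin.lastCases with
    | last =>
      have hs : ∀ h, (Fin.snoc p true : Fin (k + 2) → Bool)
          ⟨(Fin.last k).castSucc.val + 1, h⟩ = true :=
        fun _ => Fin.snoc_last (α := fun _ => Bool) _ _
      simp only [hs]
      simp
    | cast j =>
      have hs : ∀ h, (Fin.snoc p true : Fin (k + 2) → Bool)
          ⟨j.castSucc.castSucc.val + 1, h⟩ = p ⟨j.castSucc.val + 1, by simp⟩ :=
        fun _ => Fin.snoc_castSucc (α := fun _ => Bool) (i := ⟨j.val + 1, by omega⟩) ..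
      simp only [hs]
      simp [(Fin.castSucc_lt_last j).ne]
  have hlast : Fin.last (k + 1) ∉ Valleys (Fin.snoc p true : Fin (k + 2) → Bool) := by
    simp [Valleys]
  ext j
  induction j using Fin.lastCases with
  | last =>
    simp only [hlast, false_iff]
    split_ifs <;> simp [Fin.ext_iff, (Fin.is_lt _).ne]
  | cast j =>
    rw [hmem]
    split_ifs with h <;> simp [h, or_comm]

lemma posWord_last_eq_false {k : ℕ} (σ : Equiv.Perm (Fin (k + 1))) :
    posWord σ (Fin.last k) = false ↔ σ (Fin.last k) = Fin.last k := by
  simp [posWord, Fin.last_le_iff]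

lemma Avoids321.descentMonomial_valleys_snoc {k : ℕ} {σ : Equiv.Perm (Fin (k + 1))}
    (h : Avoids321 σ) :
    descentMonomial (Valleys (Fin.snoc (posWord σ) true : Fin (k + 2) → Bool)) =
      descentMonomial (DesPerm σ) +
        if σ (Fin.last k) = Fin.last k then
          (X 0 ^ (k + 1) * X 1 - 1) * descentMonomial (DesPerm σ)
        else 0 := by
  rw [valleys_snoc_true, h.desPerm_eq]
  simp only [posWord_last_eq_false]
  split_ifs
  · rw [descentMonomial_insert (by simp [Valleys]), descentMonomial_map_castSucc]
    simp only [Fin.val_castSucc, Fin.val_last]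
    ring
  · rw [descentMonomial_map_castSucc, add_zero]

lemma sum_paraSet_eq_sum_av (k : ℕ) :
    ∑ UV ∈ ParaSet (k + 2), descentMonomial (Valleys UV.2) =
      ∑ σ ∈ Av (k + 1),
        descentMonomial (Valleys (Fin.snoc (posWord σ) true : Fin (k + 2) → Bool)) := by
  symm
  refine sum_nbij (fun σ => ((Fin.cons true (valWord σ) : Fin (k + 2) → Bool),
    (Fin.snoc (posWord σ) true : Fin (k + 2) → Bool))) ?_ ?_ ?_ fun _ _ => rfl
  · intro σ _
    simpa [ParaSet] using (isParaPoly_cons_snoc _ _).2 (isEncoding_words σ)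
  · intro σ hσ τ hτ h
    simp only [Av, coe_filter, mem_univ, true_and, Set.mem_ofPred_eq] at hσ hτ
    simp only [Prod.mk.injEq] at h
    exact eq_of_words_eq hσ hτ (Fin.snoc_injective2 h.2).1 (Fin.cons_injective2 h.1).2
  · rintro ⟨U, V⟩ h
    simp only [ParaSet, coe_filter, mem_univ, true_and, Set.mem_ofPred_eq] at h
    obtain ⟨u, p, rfl, rfl⟩ := h.exists_eq_cons_snoc
    obtain ⟨σ, hσ, rfl, rfl⟩ := ((isParaPoly_cons_snoc u p).1 h).exists_perm
    exact ⟨σ, by simpa [Av] using hσ, rfl⟩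

/-- The extension of a permutation of `Fin k` by a fixed point at the end. -/
def permSnoc {k : ℕ} (τ : Equiv.Perm (Fin k)) : Equiv.Perm (Fin (k + 1)) :=
  finSuccEquivLast.symm.permCongr τ.optionCongr

@[simp]
lemma permSnoc_castSucc {k : ℕ} (τ : Equiv.Perm (Fin k)) (i : Fin k) :
    permSnoc τ i.castSucc = (τ i).castSucc := by
  simp [permSnoc, Equiv.permCongr_apply]

@[simp]
lemma permSnoc_last {k : ℕ} (τ : Equiv.Perm (Fin k)) :
    permSnoc τ (Fin.last k) = Fin.last k := by
  simp [permSnoc, Equiv.permCongr_apply]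

lemma permSnoc_injective {k : ℕ} : Function.Injective (permSnoc (k := k)) := fun τ τ' h => by
  ext1 i
  apply Fin.castSucc_injective k
  rw [← permSnoc_castSucc, h, permSnoc_castSucc]

lemma exists_permSnoc_eq {k : ℕ} {σ : Equiv.Perm (Fin (k + 1))}
    (h : σ (Fin.last k) = Fin.last k) : ∃ τ, permSnoc τ = σ := by
  let e : Equiv.Perm (Option (Fin k)) := finSuccEquivLast.permCongr σ
  have he : e none = none := by simp [e, Equiv.permCongr_apply, h]
  refine ⟨Equiv.removeNone e, ?_⟩
  have : (Equiv.removeNone e).optionCongr = e := by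
    have := Equiv.Perm.decomposeOption.symm_apply_apply e
    simpa only [Equiv.Perm.decomposeOption, Equiv.coe_fn_mk, Equiv.coe_fn_symm_mk, he,
      Equiv.swap_self, ← Equiv.Perm.one_def, one_mul] using this
  rw [permSnoc, this]
  ext1 i
  simp [e, Equiv.permCongr_apply]

lemma avoids321_permSnoc {k : ℕ} (τ : Equiv.Perm (Fin k)) :
    Avoids321 (permSnoc τ) ↔ Avoids321 τ := by
  refine not_congr ⟨?_, ?_⟩
  · rintro ⟨a, b, c, hab, hbc, h1, h2⟩
    have ha : a ≠ Fin.last k := (hab.trans_le (Fin.le_last _)).ne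
    have hb : b ≠ Fin.last k := (hbc.trans_le (Fin.le_last _)).ne
    have hc : c ≠ Fin.last k := by
      rintro rfl
      rw [permSnoc_last] at h1
      exact h1.not_ge (Fin.le_last _)
    obtain ⟨a, rfl⟩ := Fin.exists_castSucc_eq.2 ha
    obtain ⟨b, rfl⟩ := Fin.exists_castSucc_eq.2 hb
    obtain ⟨c, rfl⟩ := Fin.exists_castSucc_eq.2 hc
    simp only [permSnoc_castSucc, Fin.castSucc_lt_castSucc_iff] at *
    exact ⟨a, b, c, hab, hbc, h1, h2⟩
  · rintro ⟨a, b, c, hab, hbc, h1, h2⟩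
    exact ⟨a.castSucc, b.castSucc, c.castSucc, by simpa, by simpa, by simpa, by simpa⟩

lemma desPerm_permSnoc {k : ℕ} (τ : Equiv.Perm (Fin k)) :
    DesPerm (permSnoc τ) = (DesPerm τ).map Fin.castSuccEmb := by
  ext i
  induction i using Fin.lastCases with
  | last => simp [DesPerm, Fin.ext_iff, (Fin.is_lt _).ne]
  | cast i =>
    have hr : i.castSucc ∈ (DesPerm τ).map Fin.castSuccEmb ↔ i ∈ DesPerm τ := by simp
    rw [hr]
    simp only [DesPerm, mem_filter, mem_univ, true_and, permSnoc_castSucc]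
    constructor
    · rintro ⟨h, hlt⟩
      by_cases hi : i.val + 1 < k
      · refine ⟨hi, ?_⟩
        have : (⟨i.castSucc.val + 1, h⟩ : Fin (k + 1)) = Fin.castSucc ⟨i.val + 1, hi⟩ := rfl
        rwa [this, permSnoc_castSucc, Fin.castSucc_lt_castSucc_iff] at hlt
      · have : (⟨i.castSucc.val + 1, h⟩ : Fin (k + 1)) = Fin.last k :=
          Fin.ext (by simp only [Fin.val_castSucc, Fin.val_last]; omega)
        rw [this, permSnoc_last] at hlt
        exact absurd hlt (Fin.le_last _).not_gt
    · rintro ⟨h, hlt⟩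
      refine ⟨by simp, ?_⟩
      have : (⟨i.castSucc.val + 1, by simp⟩ : Fin (k + 1)) = Fin.castSucc ⟨i.val + 1, h⟩ := rfl
      rwa [this, permSnoc_castSucc, Fin.castSucc_lt_castSucc_iff]

lemma sum_av_filter_last (k : ℕ) :
    ∑ σ ∈ Av (k + 1) with σ (Fin.last k) = Fin.last k, descentMonomial (DesPerm σ) =
      MPoly k := by
  symm
  refine sum_nbij permSnoc ?_ permSnoc_injective.injOn ?_ ?_
  · intro τ hτ
    simpa [Av, avoids321_permSnoc] using hτ
  · intro σ hσ
    simp only [Av, coe_filter, mem_filter, mem_univ, true_and, Set.mem_ofPred_eq] at hσ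
    obtain ⟨τ, rfl⟩ := exists_permSnoc_eq hσ.2
    exact ⟨τ, by simpa [Av, avoids321_permSnoc] using hσ.1, rfl⟩
  · intro τ _
    rw [desPerm_permSnoc, descentMonomial_map_castSucc]
    rfl

/-- for n ≥ 2,
`Σ_{(U,V)∈𝒫_n} q^{maj V} t^{des V} = M_{n-1}(q,t) + (q^{n-1}t - 1) M_{n-2}(q,t)`. -/
theorem stmt9 (n : ℕ) (hn : 2 ≤ n) :
    (∑ UV ∈ ParaSet n, (X 0 : MvPolynomial (Fin 2) ℤ) ^ majPath UV.2 * X 1 ^ desPath UV.2) =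
      MPoly (n - 1) + (X 0 ^ (n - 1) * X 1 - 1) * MPoly (n - 2) := by
  obtain ⟨k, rfl⟩ := Nat.exists_eq_add_of_le' hn
  change ∑ UV ∈ ParaSet (k + 2), descentMonomial (Valleys UV.2) =
    MPoly (k + 1) + (X 0 ^ (k + 1) * X 1 - 1) * MPoly k
  rw [sum_paraSet_eq_sum_av, sum_congr rfl fun σ (hσ : σ ∈ Av (k + 1)) =>
    (mem_filter.1 hσ).2.descentMonomial_valleys_snoc, sum_add_distrib, ← sum_filter,
    ← mul_sum, sum_av_filter_last]
  rfl
end
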